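/- Let q be a power of an odd prime, m ≥ 2, and let f(x) = a·x^2 + b·x + c with a, b, c ∈ F_{q^m}, a ≠ 0 and b^2 − 4ac ≠ 0. Let e_1 and e_2 be divisors of q^m − 1 and let g be a monic divisor of x^m − 1 in F_q[x]. If q^{m/2} > 3·W(e_1)·W(e_2)·Ω(g), then there exists α ∈ F_{q^m} such that α is e_1-free and g-free and f(α) is e_2-free. -/

import Mathlib

open Polynomial

/-- For `e ∣ q^m - 1`, a nonzero element `α` of `F_{q^m}` is *e-free* if whenever `d ∣ e` and
`α = β^d` for some `β`, then `d = 1`. -/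
def IsEFree {K : Type*} [Field K] (e : ℕ) (α : K) : Prop :=
  α ≠ 0 ∧ ∀ d : ℕ, d ∣ e → (∃ β : K, α = β ^ d) → d = 1

/-- The additive `F_q[x]`-module action on `F_{q^m}`: `h ∘ α = Σ aᵢ α^{qⁱ}` for
`h = Σ aᵢ xⁱ ∈ F_q[x]`. -/
noncomputable def polyAct (F : Type*) {K : Type*} [Field F] [Fintype F] [Field K] [Algebra F K]
    (h : Polynomial F) (α : K) : K :=
  h.sum fun i a => algebraMap F K a * α ^ (Fintype.card F) ^ i

/-- For a monic divisor `g` of `x^m - 1`, an element `α ∈ F_{q^m}` is *g-free* if whenever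
`h` is a monic divisor of `g` and `α = h ∘ β` for some `β`, then `h = 1`. -/
def IsGFree (F : Type*) {K : Type*} [Field F] [Fintype F] [Field K] [Algebra F K]
    (g : Polynomial F) (α : K) : Prop :=
  ∀ h : Polynomial F, h.Monic → h ∣ g → (∃ β : K, α = polyAct F h β) → h = 1



/-- Kummer irreducibility in the presence of roots of unity. -/
theorem kummer_irred {M : Type*} [Field M] {d : ℕ} (hd : 0 < d) {ζ : M} (hζ : IsPrimitiveRoot ζ d)
    (u : M) (hu0 : u ≠ 0) (hu : ∀ l : ℕ, l.Prime → l ∣ d → ∀ v : M, v ^ l ≠ u) :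
    Irreducible (X ^ d - C u : M[X]) := by
  obtain ⟨w, hw⟩ := IsAlgClosed.exists_pow_nat_eq (algebraMap M (AlgebraicClosure M) u) hd
  have hw0 : w ≠ 0 := by
    rintro rfl
    rw [zero_pow hd.ne'] at hw
    exact hu0 (by simpa using hw.symm)
  have hmon : (X ^ d - C u : M[X]).Monic := monic_X_pow_sub_C u hd.ne'
  have hwint : IsIntegral M w := Algebra.IsIntegral.isIntegral w
  have hdvd : minpoly M w ∣ X ^ d - C u := minpoly.dvd _ _ (by simp [hw])
  have hζ' : IsPrimitiveRoot (algebraMap M (AlgebraicClosure M) ζ) d :=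
    hζ.map_of_injective (algebraMap M (AlgebraicClosure M)).injective
  have hspl : ((minpoly M w).map (algebraMap M (AlgebraicClosure M))).Splits :=
    IsAlgClosed.splits _
  -- product of roots
  set P := (minpoly M w).map (algebraMap M (AlgebraicClosure M)) with hP
  have hPm : P.Monic := (minpoly.monic hwint).map _
  have hroots : ∀ r ∈ P.roots, ∃ z : M, r = algebraMap M (AlgebraicClosure M) z * w := by
    intro r hr
    have hr' : aeval r (minpoly M w) = 0 := by
      have := (mem_roots hPm.ne_zero).1 hr
      simpa [hP, IsRoot.def, eval_map_algebraMap] using this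
    have hr2 : r ^ d = w ^ d := by
      obtain ⟨q, hq⟩ := hdvd
      have : aeval r (X ^ d - C u : M[X]) = 0 := by rw [hq]; simp [hr']
      rw [hw]
      simpa [sub_eq_zero] using this
    have : (r / w) ^ d = 1 := by rw [div_pow, hr2, div_self (pow_ne_zero _ hw0)]
    have hNZ : NeZero d := ⟨hd.ne'⟩
    obtain ⟨i, _, hi⟩ := hζ'.eq_pow_of_pow_eq_one this
    refine ⟨ζ ^ i, ?_⟩
    rw [map_pow, hi, div_mul_cancel₀ _ hw0]
  have hprod : ∀ S : Multiset (AlgebraicClosure M),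
      (∀ r ∈ S, ∃ z : M, r = algebraMap M (AlgebraicClosure M) z * w) →
      ∃ z : M, S.prod = algebraMap M (AlgebraicClosure M) z * w ^ (Multiset.card S) := by
    intro S
    induction S using Multiset.induction with
    | empty => intro _; exact ⟨1, by simp⟩
    | cons a S ih =>
      intro h
      obtain ⟨z, hz⟩ := ih (fun r hr => h r (Multiset.mem_cons_of_mem hr))
      obtain ⟨y, hy⟩ := h a (Multiset.mem_cons_self a S)
      refine ⟨y * z, ?_⟩
      rw [Multiset.prod_cons, hz, hy, Multiset.card_cons, map_mul]
      ring
  obtain ⟨z, hz⟩ := hprod _ hroots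
  have hcard : Multiset.card P.roots = (minpoly M w).natDegree := by
    rw [← hspl.natDegree_eq_card_roots, hP, natDegree_map]
  set k := (minpoly M w).natDegree with hk
  have hkpos : 0 < k := minpoly.natDegree_pos hwint
  have hkd : k ≤ d := by
    have := natDegree_le_of_dvd hdvd hmon.ne_zero
    simpa using this
  -- w ^ k ∈ M
  have hcoef : algebraMap M (AlgebraicClosure M) ((minpoly M w).coeff 0) =
      (-1) ^ k * P.roots.prod := by
    have := hspl.coeff_zero_eq_prod_roots_of_monic hPm
    rw [hP, coeff_map, natDegree_map] at this
    exact this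
  have hwk : ∃ v : M, algebraMap M (AlgebraicClosure M) v = w ^ k := by
    have hc0 : (minpoly M w).coeff 0 ≠ 0 := minpoly.coeff_zero_ne_zero hwint hw0
    have hz0 : z ≠ 0 := by
      rintro rfl
      rw [hz] at hcoef
      simp at hcoef
      exact hc0 hcoef
    refine ⟨(-1) ^ k * (minpoly M w).coeff 0 / z, ?_⟩
    rw [map_div₀, map_mul, hcoef, hz, hcard]
    have : algebraMap M (AlgebraicClosure M) z ≠ 0 := by simpa using hz0
    field_simp
    simp [← mul_pow]
  obtain ⟨v, hv⟩ := hwk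
  rcases hkd.lt_or_eq with hlt | heq
  · exfalso
    -- w ^ gcd ∈ M
    have hv0 : v ≠ 0 := by
      rintro rfl
      rw [map_zero] at hv
      exact pow_ne_zero k hw0 hv.symm
    set e := Nat.gcd k d with he
    have hb : (e : ℤ) = k * Nat.gcdA k d + d * Nat.gcdB k d := Nat.gcd_eq_gcd_ab k d
    have hwe : algebraMap M (AlgebraicClosure M) (v ^ (Nat.gcdA k d) * u ^ (Nat.gcdB k d)) = w ^ e := by
      rw [map_mul, map_zpow₀, map_zpow₀, hv, ← hw, ← zpow_natCast w e, hb, zpow_add₀ hw0,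
        zpow_mul, zpow_mul, zpow_natCast, zpow_natCast]
    have hed : e ∣ d := Nat.gcd_dvd_right k d
    have helt : e < d := lt_of_le_of_lt (Nat.gcd_le_left d hkpos) hlt
    obtain ⟨t, ht⟩ := hed
    have ht1 : t ≠ 1 := by rintro rfl; omega
    obtain ⟨l, hl, hlt'⟩ := Nat.exists_prime_and_dvd ht1
    obtain ⟨t', rfl⟩ := hlt'
    refine hu l hl (ht ▸ (dvd_mul_of_dvd_right (dvd_mul_right _ _) _))
      ((v ^ (Nat.gcdA k d) * u ^ (Nat.gcdB k d)) ^ t') ?_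
    apply (algebraMap M (AlgebraicClosure M)).injective
    rw [map_pow, map_pow, hwe, ← hw, ← pow_mul, ← pow_mul, ht]
    congr 1; ring
  · have : minpoly M w = X ^ d - C u := by
      symm
      apply eq_of_monic_of_dvd_of_natDegree_le (minpoly.monic hwint) hmon hdvd
      simp [← hk, heq]
    rw [← this]
    exact minpoly.irreducible hwint


/-- Ramification condition on `H`: for each prime `l ∣ d`, `H` has a root whose multiplicity is not
divisible by `l`, in a form stable under base change. -/
def KCond {k : Type*} [Field k] (d : ℕ) (H : k[X]) : Prop :=
  H ≠ 0 ∧ ∀ l : ℕ, l.Prime → l ∣ d → ∃ (A B : k[X]) (e : ℕ), H = A ^ e * B ∧ A.Separable ∧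
    0 < A.natDegree ∧ IsCoprime A B ∧ ¬ l ∣ e

theorem KCond.map {k k' : Type*} [Field k] [Field k'] {d : ℕ} {H : k[X]} (h : KCond d H)
    (φ : k →+* k') : KCond d (H.map φ) := by
  refine ⟨(Polynomial.map_ne_zero_iff φ.injective).2 h.1, fun l hl hld => ?_⟩
  obtain ⟨A, B, e, h1, h2, h3, h4, h5⟩ := h.2 l hl hld
  refine ⟨A.map φ, B.map φ, e, by rw [h1]; simp, h2.map, by rwa [natDegree_map], ?_, h5⟩
  exact h4.map (mapRingHom φ)

theorem KCond.not_pow {k : Type*} [Field k] {d : ℕ} {H : k[X]} (h : KCond d H) {l : ℕ}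
    (hl : l.Prime) (hld : l ∣ d) (a b : k[X][X]) (hb : b ≠ 0)
    (hab : a ^ l * H.map C = b ^ l * C H) : False := by
  obtain ⟨A, B, e, h1, h2, h3, h4, h5⟩ := h.2 l hl hld
  have hA0 : A ≠ 0 := by rintro rfl; simp at h3
  obtain ⟨π, hπ, hπA⟩ := WfDvdMonoid.exists_irreducible_factor
    (fun hu => by rw [natDegree_eq_zero_of_isUnit hu] at h3; exact lt_irrefl _ h3) hA0
  have hp : Prime (C π : k[X][X]) := prime_C_iff.2 hπ.prime
  have hHX : (H.map C : k[X][X]) ≠ 0 := (Polynomial.map_ne_zero_iff C_injective).2 h.1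
  have hCH : (C H : k[X][X]) ≠ 0 := C_ne_zero.2 h.1
  have ha : a ≠ 0 := by
    rintro rfl
    rw [zero_pow hl.ne_zero, zero_mul] at hab
    exact mul_ne_zero (pow_ne_zero _ hb) hCH hab.symm
  have fin : ∀ x : k[X][X], x ≠ 0 → FiniteMultiplicity (C π : k[X][X]) x := fun x hx =>
    FiniteMultiplicity.of_prime_left hp hx
  have hm := congrArg (multiplicity (C π : k[X][X])) hab
  rw [multiplicity_mul hp (fin _ (mul_ne_zero (pow_ne_zero _ ha) hHX)),
    multiplicity_mul hp (fin _ (mul_ne_zero (pow_ne_zero _ hb) hCH)),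
    (fin a ha).multiplicity_pow hp, (fin b hb).multiplicity_pow hp] at hm
  have m1 : multiplicity (C π : k[X][X]) (H.map C) = 0 := by
    rw [multiplicity_eq_zero]
    intro hdvd
    rw [C_dvd_iff_dvd_coeff] at hdvd
    have := hdvd H.natDegree
    rw [coeff_map] at this
    exact hπ.not_isUnit (isUnit_of_dvd_unit this
      (isUnit_C.2 (isUnit_iff_ne_zero.2 (leadingCoeff_ne_zero.2 h.1))))
  have m2 : multiplicity (C π : k[X][X]) (C H) = e := by
    have hBn : ¬ π ∣ B := fun hB => hπ.not_isUnit (h4.isUnit_of_dvd' hπA hB)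
    apply multiplicity_eq_of_dvd_of_not_dvd
    · rw [← C_pow, h1]
      exact map_dvd C ((pow_dvd_pow_of_dvd hπA e).mul_right B)
    · rw [← C_pow, C_dvd_iff_dvd_coeff]
      intro hdvd
      have h0 := hdvd 0
      rw [coeff_C_zero, h1] at h0
      have h6 : π ^ (e + 1) ∣ A ^ e := by
        refine IsCoprime.dvd_of_dvd_mul_right ?_ h0
        exact ((hπ.coprime_iff_not_dvd).2 hBn).pow_left
      obtain ⟨A', rfl⟩ := hπA
      have hπA' : ¬ π ∣ A' := by
        intro hh
        exact hπ.not_isUnit (h2.squarefree π (mul_dvd_mul_left π hh))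
      rw [mul_pow, pow_succ] at h6
      have h7 : π ∣ A' ^ e := (mul_dvd_mul_iff_left (pow_ne_zero e hπ.ne_zero)).1 h6
      exact hπA' (hπ.prime.dvd_of_dvd_pow h7)
  rw [m1, m2] at hm
  apply h5
  have : (l : ℕ) ∣ l * multiplicity (C π : k[X][X]) b + e := by
    rw [← hm]; simp
  exact (Nat.dvd_add_right (dvd_mul_right _ _)).1 this

/-- Kronecker substitution `Y ↦ X ^ s`. -/
noncomputable def kron (k : Type*) [Field k] (s : ℕ) : k[X][X] →+* k[X] :=
  eval₂RingHom ((expand k s : k[X] →ₐ[k] k[X]) : k[X] →+* k[X]) X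

theorem kron_ne_zero {k : Type*} [Field k] {s : ℕ} (R : k[X][X]) (hR : R ≠ 0)
    (hs : R.natDegree < s) : kron k s R ≠ 0 := by
  have hs0 : 0 < s := by omega
  obtain ⟨j, hj⟩ : ∃ j, R.coeff j ≠ 0 := by
    by_contra hcon
    push Not at hcon
    exact hR (by ext1 j; simpa using hcon j)
  obtain ⟨i, hi⟩ : ∃ i, (R.coeff j).coeff i ≠ 0 := by
    by_contra hcon
    push Not at hcon
    exact hj (by ext1 i; simpa using hcon i)
  have hjs : j < s := lt_of_le_of_lt (le_natDegree_of_ne_zero hj) hs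
  intro h0
  apply hi
  have hc := congrArg (fun P => coeff P (i * s + j)) h0
  simp only [kron, coe_eval₂RingHom, coeff_zero] at hc
  rw [eval₂_eq_sum_range, finsetSum_coeff, Finset.sum_eq_single j] at hc
  · have h2 : coeff ((expand k s) (R.coeff j) * X ^ j) (i * s + j) = (R.coeff j).coeff i := by
      rw [coeff_mul_X_pow, coeff_expand_mul hs0]
    rw [← h2]; exact hc
  · intro b hb hbj
    have hbs : b < s := lt_of_le_of_lt (Nat.lt_succ_iff.1 (Finset.mem_range.1 hb)) hs
    have h2 : coeff ((expand k s) (R.coeff b) * X ^ b) (i * s + j) = 0 := by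
      rw [coeff_mul_X_pow']
      split_ifs with hle
      · rw [coeff_expand hs0]
        split_ifs with hdvd
        · exfalso
          apply hbj
          have h3 : (i * s + j) ≡ b [MOD s] := ((Nat.modEq_iff_dvd' hle).2 hdvd).symm
          have h4 : j ≡ b [MOD s] := by
            have h5 : (i * s + j) ≡ j [MOD s] := by simp [Nat.ModEq]
            exact h5.symm.trans h3
          have := Nat.ModEq.eq_of_lt_of_lt h4 hjs hbs
          exact this.symm
        · rfl
      · rfl
    exact h2
  · intro hj'
    exfalso
    apply hj'
    rw [Finset.mem_range]
    exact Nat.lt_succ_of_le (le_natDegree_of_ne_zero hj)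


theorem natDegree_det_col_le {R : Type*} [CommRing R] {n : ℕ} (A : Matrix (Fin n) (Fin n) R[X])
    (w : Fin n → ℕ) (hA : ∀ i j, (A i j).natDegree ≤ w j) : A.det.natDegree ≤ ∑ j, w j := by
  rw [Matrix.det_apply]
  apply natDegree_sum_le_of_forall_le
  intro σ _
  refine (natDegree_smul_le _ _).trans ?_
  refine (natDegree_prod_le _ _).trans ?_
  exact Finset.sum_le_sum fun j _ => hA _ _

theorem natDegree_resultant_le {R : Type*} [CommRing R] (f g : R[X][X]) (m n a b : ℕ)
    (hf : ∀ i, (f.coeff i).natDegree ≤ a) (hg : ∀ i, (g.coeff i).natDegree ≤ b) :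
    (resultant f g m n).natDegree ≤ m * b + n * a := by
  have := natDegree_det_col_le (sylvester f g m n)
    (fun j => Fin.addCases (fun _ => b) (fun _ => a) j) ?_
  · refine this.trans ?_
    rw [Fin.sum_univ_add]
    simp
  · intro i j
    induction j using Fin.addCases with
    | left j =>
      simp only [sylvester, Matrix.of_apply, Fin.addCases_left]
      split_ifs
      · exact hg _
      · simp
    | right j =>
      simp only [sylvester, Matrix.of_apply, Fin.addCases_right]
      split_ifs
      · exact hf _
      · simp

theorem nonvanish {k : Type*} [Field k] {d : ℕ} (hd : 0 < d) {ζ : k} (hζ : IsPrimitiveRoot ζ d)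
    {H : k[X]} (hH : KCond d H) {s : ℕ} (g : k[X]) (hg : g ^ d * H = expand k s H)
    (h : k[X][X][X]) (h0 : h ≠ 0) (hdeg : h.natDegree < d) (μ : ℕ)
    (hμ : ∀ i, (h.coeff i).natDegree ≤ μ) (hs : d * μ + d * H.natDegree < s) :
    eval g (h.map (kron k s)) ≠ 0 := by
  have hHX : (H.map C : k[X][X]) ≠ 0 := (Polynomial.map_ne_zero_iff C_injective).2 hH.1
  have hCH : (C H : k[X][X]) ≠ 0 := C_ne_zero.2 hH.1
  set f : k[X][X][X] := C (H.map C) * X ^ d - C (C H) with hf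
  have hfdeg : f.natDegree = d := by
    rw [hf, natDegree_sub_C, natDegree_C_mul_X_pow _ _ hHX]
  set res := resultant f h f.natDegree h.natDegree with hres
  have hfc : ∀ i, (f.coeff i).natDegree ≤ H.natDegree := by
    intro i
    rw [hf, coeff_sub, coeff_C_mul_X_pow]
    refine (natDegree_sub_le _ _).trans (max_le ?_ ?_)
    · split_ifs
      · exact natDegree_map_le
      · simp
    · rw [coeff_C]
      split_ifs <;> simp
  have hresdeg : res.natDegree < s := by
    refine lt_of_le_of_lt (natDegree_resultant_le f h _ _ _ _ hfc hμ) ?_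
    rw [hfdeg]
    refine lt_of_le_of_lt ?_ hs
    gcongr
  have hres0 : res ≠ 0 := by
    let M := FractionRing k[X][X]
    let φ : k[X][X] →+* M := algebraMap _ _
    have hφ : Function.Injective φ := IsFractionRing.injective k[X][X] M
    intro hr
    have h1 : resultant (f.map φ) (h.map φ) = 0 := by
      rw [natDegree_map_eq_of_injective hφ, natDegree_map_eq_of_injective hφ, resultant_map_map,
        ← hres, hr, map_zero]
    rw [resultant_eq_zero_iff] at h1
    apply h1.2
    set u : M := φ (C H) / φ (H.map C) with hu
    have ha0 : φ (H.map C) ≠ 0 := (map_ne_zero_iff φ hφ).2 hHX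
    have hb0 : φ (C H) ≠ 0 := (map_ne_zero_iff φ hφ).2 hCH
    have hfm : f.map φ = C (φ (H.map C)) * (X ^ d - C u) := by
      rw [hf, mul_sub, ← C_mul, hu, mul_div_cancel₀ _ ha0]
      simp
    have hirr : Irreducible (X ^ d - C u : M[X]) := by
      have hinj : Function.Injective (algebraMap k[X][X] M |>.comp (C.comp C : k →+* k[X][X])) :=
        RingHom.injective _
      apply kummer_irred hd (hζ.map_of_injective hinj) u (div_ne_zero hb0 ha0)
      intro l hl hld v hv
      obtain ⟨a, b, hb, rfl⟩ := IsFractionRing.div_surjective (A := k[X][X]) v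
      have hb' : b ≠ 0 := nonZeroDivisors.ne_zero hb
      refine hH.not_pow hl hld a b hb' ?_
      apply hφ
      have hb'' : φ b ≠ 0 := (map_ne_zero_iff φ hφ).2 hb'
      change (φ a / φ b) ^ l = u at hv
      rw [hu, div_pow, div_eq_div_iff (pow_ne_zero _ hb'') ha0] at hv
      rw [map_mul, map_mul, map_pow, map_pow, hv, mul_comm]
    rw [hfm]
    refine (isCoprime_mul_unit_left_left (isUnit_C.2 (isUnit_iff_ne_zero.2 ha0)) _ _).2 ?_
    refine (hirr.coprime_iff_not_dvd).2 fun hdvd => ?_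
    have hh0 : h.map φ ≠ 0 := (Polynomial.map_ne_zero_iff hφ).2 h0
    have := natDegree_le_of_dvd hdvd hh0
    rw [natDegree_map_eq_of_injective hφ, natDegree_X_pow_sub_C] at this
    omega
  obtain ⟨P, Q, -, -, hPQ⟩ := exists_mul_add_mul_eq_C_resultant f h le_rfl le_rfl
    (Or.inl (by omega))
  intro hzero
  apply kron_ne_zero res hres0 hresdeg
  have key := congrArg (fun T => eval g (T.map (kron k s))) hPQ
  simp only [Polynomial.map_add, Polynomial.map_mul, eval_add, eval_mul, hzero, zero_mul, add_zero,
    map_C, eval_C] at key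
  rw [← hres] at key
  rw [← key]
  have hk1 : kron k s (H.map C) = H := by
    simp only [kron, coe_eval₂RingHom, eval₂_map]
    have : ((expand k s : k[X] →ₐ[k] k[X]) : k[X] →+* k[X]).comp C = C := by
      ext a; simp
    rw [this]; exact eval₂_C_X
  have hk2 : kron k s (C H) = expand k s H := by
    simp [kron]
  have : eval g (f.map (kron k s)) = 0 := by
    rw [hf]
    simp only [Polynomial.map_sub, Polynomial.map_mul, map_C, Polynomial.map_pow, map_X, eval_sub,
      eval_mul, eval_C, eval_pow, eval_X, hk1, hk2]
    rw [← hg]; ring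
  rw [this, zero_mul]


theorem stepanov_aux {L : Type*} [Field L] [Fintype L] [DecidableEq L] {p e s : ℕ} [Fact p.Prime] [CharP L p]
    (hs : s = p ^ e) (hL : Fintype.card L = s ^ 2) {d t : ℕ} (hd : 0 < d) (hdt : s = d * t + 1)
    {ζ : L} (hζ : IsPrimitiveRoot ζ d) (H : L[X]) (hH : KCond d H) (hexp : expand L s H = H ^ s)
    (u : L) (hu : u ≠ 0) (l m : ℕ) (hm : 0 < m) 
    (hdim : m * s + l + H.natDegree * s < d * l * m)
    (hmd : d * (m - 1) + d * H.natDegree < s) :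
    (Finset.univ.filter fun z : L => (eval z H) ^ (t * (s + 1)) = u).card ≤
      m + l * s + H.natDegree * s := by
  set G : L[X] := H ^ t with hG
  have hs0 : 0 < s := by omega
  have hdegG : ∀ n ≤ d - 1, (G ^ n).natDegree ≤ H.natDegree * s := by
    intro n hn
    rw [hG, ← pow_mul, natDegree_pow, mul_comm]
    apply Nat.mul_le_mul_left
    have : t * n ≤ t * d := Nat.mul_le_mul_left _ (by omega)
    rw [hdt]; linarith [mul_comm t d]
  set B := m * s + l + H.natDegree * s with hB
  let ι := Fin d × Fin l × Fin m
  let v : ι → L[X] := fun x => C (u ^ (x.1 : ℕ)) * G ^ (d - 1 - (x.1 : ℕ)) *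
    X ^ ((x.2.2 : ℕ) * s + (x.2.1 : ℕ))
  have hv : ∀ x, v x ∈ degreeLT L B := by
    intro x
    rw [mem_degreeLT]
    by_cases hz : v x = 0
    · rw [hz, degree_zero]; exact WithBot.bot_lt_coe _
    rw [degree_eq_natDegree hz]
    norm_cast
    have h1 : (v x).natDegree ≤ 0 + H.natDegree * s + ((x.2.2 : ℕ) * s + (x.2.1 : ℕ)) := by
      refine natDegree_mul_le.trans (add_le_add (natDegree_mul_le.trans (add_le_add ?_ ?_)) ?_)
      · simp
      · exact hdegG _ (by omega)
      · simp
    refine lt_of_le_of_lt h1 ?_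
    have h2 : (x.2.2 : ℕ) * s ≤ m * s := Nat.mul_le_mul_right _ x.2.2.2.le
    have h3 := x.2.1.2
    omega
  let Φ : (ι → L) →ₗ[L] degreeLT L B := Fintype.linearCombination L (fun x => (⟨v x, hv x⟩ : degreeLT L B))
  obtain ⟨c', hc', hc'0⟩ : ∃ c' : ι → L, Φ c' = 0 ∧ c' ≠ 0 := by
    have hker : LinearMap.ker Φ ≠ ⊥ := by
      apply LinearMap.ker_ne_bot_of_finrank_lt
      rw [(degreeLTEquiv L B).finrank_eq, Module.finrank_fintype_fun_eq_card,
        Module.finrank_fintype_fun_eq_card]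
      simp only [Fintype.card_fin, ι, Fintype.card_prod]
      rw [← mul_assoc]; exact hdim
    obtain ⟨x, hx, hx0⟩ := Submodule.exists_mem_ne_zero_of_ne_bot hker
    exact ⟨x, hx, hx0⟩
  have hsum : ∑ x, C (c' x) * v x = 0 := by
    have := congrArg Subtype.val hc'
    simpa [Φ, Fintype.linearCombination_apply, smul_eq_C_mul] using this
  let hp : L[X][X][X] := ∑ x : ι, monomial (x.1 : ℕ) (monomial (x.2.2 : ℕ) (monomial (x.2.1 : ℕ) (c' x ^ s)))
  have hcoef : ∀ x : ι, ((hp.coeff x.1).coeff x.2.2).coeff x.2.1 = c' x ^ s := by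
    intro x
    simp only [hp, finsetSum_coeff]
    rw [Finset.sum_eq_single x]
    · simp
    · rintro ⟨a, b, c⟩ - hne
      rw [coeff_monomial]
      split_ifs with h1
      · rw [coeff_monomial]
        split_ifs with h2
        · rw [coeff_monomial]
          split_ifs with h3
          · exfalso; apply hne
            exact Prod.ext (Fin.ext h1) (Prod.ext (Fin.ext h3) (Fin.ext h2))
          · rfl
        · simp
      · simp
    · simp
  have hp0 : hp ≠ 0 := by
    intro h0
    apply hc'0
    funext x
    have := hcoef x
    rw [h0] at this
    simp only [coeff_zero] at this
    exact pow_eq_zero_iff hs0.ne' |>.1 this.symm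
  have hpdeg : hp.natDegree < d := by
    refine lt_of_le_of_lt (natDegree_sum_le_of_forall_le (n := d - 1) _ _ ?_) (by omega)
    intro x _
    refine (natDegree_monomial_le _).trans (by have := x.1.2; omega)
  have hpμ : ∀ i, (hp.coeff i).natDegree ≤ m - 1 := by
    intro i
    simp only [hp, finsetSum_coeff]
    refine natDegree_sum_le_of_forall_le _ _ ?_
    intro x _
    rw [coeff_monomial]
    split_ifs
    · refine (natDegree_monomial_le _).trans (by have := x.2.2.2; omega)
    · simp
  have hg : G ^ d * H = expand L s H := by
    rw [hexp, hG, ← pow_mul, ← pow_succ, hdt, mul_comm t d]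
  have hne := nonvanish hd hζ hH G hg hp hp0 hpdeg (m - 1) hpμ hmd
  set F := eval G (hp.map (kron L s)) with hF
  have hFeq : F = ∑ x : ι, C (c' x ^ s) * X ^ (s * (x.2.1 : ℕ)) * X ^ (x.2.2 : ℕ) * G ^ (x.1 : ℕ) := by
    rw [hF]
    simp only [hp, Polynomial.map_sum, eval_finsetSum, map_monomial, eval_monomial]
    refine Finset.sum_congr rfl fun x _ => ?_
    congr 1
    simp only [kron, coe_eval₂RingHom, eval₂_monomial]
    congr 1
    simp only [← C_mul_X_pow_eq_monomial]
    simp [pow_mul]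
  have hFdeg : F.natDegree ≤ m + l * s + H.natDegree * s := by
    rw [hFeq]
    refine natDegree_sum_le_of_forall_le _ _ ?_
    intro x _
    have h1 : (C (c' x ^ s) * X ^ (s * (x.2.1 : ℕ)) * X ^ (x.2.2 : ℕ) * G ^ (x.1 : ℕ)).natDegree ≤
        0 + (s * (x.2.1 : ℕ)) + (x.2.2 : ℕ) + H.natDegree * s := by
      refine natDegree_mul_le.trans (add_le_add (natDegree_mul_le.trans (add_le_add
        (natDegree_mul_le.trans (add_le_add ?_ ?_)) ?_)) ?_)
      · simp
      · simp
      · simp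
      · exact hdegG _ (by have := x.1.2; omega)
    refine h1.trans ?_
    have h2 : s * (x.2.1 : ℕ) ≤ l * s := by
      rw [mul_comm]; exact Nat.mul_le_mul_right _ x.2.1.2.le
    have h3 := x.2.2.2
    omega
  refine le_trans ?_ hFdeg
  refine card_le_degree_of_subset_roots ?_
  intro z hz
  rw [Finset.mem_val, Finset.mem_filter] at hz
  rw [mem_roots hne, IsRoot.def]
  have hz' := hz.2
  set y := eval z G with hy
  have hyu : y ^ (s + 1) = u := by
    rw [← hz', hy, hG, eval_pow, ← pow_mul]
  have hy0 : y ≠ 0 := by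
    intro h0
    rw [h0, zero_pow (by omega)] at hyu
    exact hu hyu.symm
  have hcardpow : ∀ w : L, (w ^ s) ^ s = w := by
    intro w
    rw [← pow_mul, ← sq, ← hL, FiniteField.pow_card]
  have hev := congrArg (eval z) hsum
  simp only [eval_finsetSum, eval_mul, eval_C, eval_zero, v, eval_pow, eval_X] at hev
  rw [← hy] at hev
  have hFz : (eval z F) ^ s * y ^ (d - 1) = 0 := by
    rw [← hev, hFeq]
    simp only [eval_finsetSum, eval_mul, eval_C, eval_pow, eval_X]
    rw [← hy, hs, sum_pow_char_pow, ← hs, Finset.sum_mul]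
    refine Finset.sum_congr rfl fun x _ => ?_
    have hx := x.1.2
    have e1 : y ^ (d - 1) = y ^ (x.1 : ℕ) * y ^ (d - 1 - (x.1 : ℕ)) := by
      rw [← pow_add]; congr 1; omega
    rw [mul_pow, mul_pow, mul_pow, hcardpow, e1, ← hyu]
    have e2 : (z ^ (s * (x.2.1 : ℕ))) ^ s = z ^ (x.2.1 : ℕ) := by
      rw [pow_mul, ← pow_mul, mul_comm (x.2.1 : ℕ) s, pow_mul, hcardpow]
    rw [e2]
    ring
  rcases mul_eq_zero.1 hFz with h | h
  · exact pow_eq_zero_iff hs0.ne' |>.1 h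
  · exact absurd h (pow_ne_zero _ hy0)


theorem stepanov_bound {L : Type*} [Field L] [Fintype L] [DecidableEq L] {p e s : ℕ}
    [Fact p.Prime] [CharP L p] (hs : s = p ^ e) (hL : Fintype.card L = s ^ 2)
    {d t : ℕ} (hd : 2 ≤ d) (hdt : s = d * t + 1) {ζ : L} (hζ : IsPrimitiveRoot ζ d)
    (H : L[X]) (hH : KCond d H) (hexp : expand L s H = H ^ s) (u : L) (hu : u ≠ 0) :
    d * (Finset.univ.filter fun z : L => (eval z H) ^ (t * (s + 1)) = u).card ≤
      s ^ 2 + d * (2 * (d * H.natDegree + 2) + H.natDegree + 2) * s := by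
  set h := H.natDegree with hh
  set N := (Finset.univ.filter fun z : L => (eval z H) ^ (t * (s + 1)) = u).card with hN
  by_cases hsmall : t ≤ h ∨ s < 2 * (d * h + 2)
  · have hs2 : s ≤ 2 * (d * h + 2) := by
      rcases hsmall with h1 | h1
      · have := Nat.mul_le_mul_left d h1
        omega
      · omega
    have hNs : N ≤ s ^ 2 := by
      rw [← hL]; exact Finset.card_le_univ _
    have h3 : s ^ 2 ≤ 2 * (d * h + 2) * s := by
      rw [sq]; exact Nat.mul_le_mul_right _ hs2
    have h4 : N ≤ (2 * (d * h + 2) + h + 2) * s := by nlinarith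
    have := Nat.mul_le_mul_left d h4
    nlinarith
  · push Not at hsmall
    obtain ⟨h1, h2⟩ := hsmall
    obtain ⟨m, rfl⟩ : ∃ m, t = h + m := ⟨t - h, by omega⟩
    have key := stepanov_aux hs hL (by omega) hdt hζ H hH hexp u hu (h + m + (d * h + 2) + 1) m
      (by omega) (by
        rw [← hh]
        nlinarith [Nat.mul_le_mul_right (h+m) hd, Nat.mul_le_mul_right (d * h + 2) hd, mul_le_mul h2 (Nat.mul_le_mul_right (h+m) hd)  (Nat.zero_le _) (Nat.zero_le _)])
      (by
        rw [← hh, hdt]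
        have : d * (m - 1) ≤ d * m := Nat.mul_le_mul_left d (by omega)
        nlinarith)
    rw [← hh, ← hN] at key
    have h5 : d * (h + m) ≤ s := by omega
    have h6 : d * (h+m) * s ≤ s * s := Nat.mul_le_mul_right _ h5
    have h7 : d * m ≤ d * s := by
      apply Nat.mul_le_mul_left; nlinarith
    have := Nat.mul_le_mul_left d key
    nlinarith [Nat.zero_le (d * (d*h+2) * s), Nat.zero_le (d * h * s), Nat.zero_le (d*s)]

theorem expand_pow_card {K : Type*} [Field K] [Fintype K] (H : K[X]) (k : ℕ) :
    expand K (Fintype.card K ^ k) H = H ^ (Fintype.card K ^ k) := by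
  induction k with
  | zero => simp
  | succ k ih =>
    rw [pow_succ, expand_mul, FiniteField.expand_card, map_pow, ih, ← pow_mul]

theorem mulChar_generator {K : Type*} [Field K] [Finite K] (χ : MulChar K ℂ) (x y : K) (hx : x ≠ 0)
    (hy : y ≠ 0) (hxy : χ x = χ y) (n : ℕ) (hn : orderOf χ * n = Nat.card Kˣ) : x ^ n = y ^ n := by
  obtain ⟨g, hg⟩ := IsCyclic.exists_generator (α := Kˣ)
  lift x to Kˣ using hx.isUnit
  lift y to Kˣ using hy.isUnit
  suffices h : (x / y) ^ n = 1 by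
    rw [div_pow, div_eq_one] at h
    exact_mod_cast h
  have hg' : ∀ a : Kˣ, ∃ j : ℕ, g ^ j = a := by
    intro a
    have := hg a
    rw [← mem_powers_iff_mem_zpowers] at this
    exact (Submonoid.mem_powers_iff _ _).1 this
  have hord : ∀ j : ℕ, χ (g : K) ^ j = 1 → orderOf χ ∣ j := by
    intro j hj
    apply orderOf_dvd_of_pow_eq_one
    ext a
    obtain ⟨i, rfl⟩ := hg' a
    rw [MulChar.pow_apply_coe, MulChar.one_apply_coe, Units.val_pow_eq_pow_val, map_pow,
      ← pow_mul, mul_comm, pow_mul, hj, one_pow]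
  obtain ⟨k, hk⟩ := hg' (x / y)
  have h1 : χ (g : K) ^ k = 1 := by
    rw [← map_pow, ← Units.val_pow_eq_pow_val, hk]
    have h2 : χ ((x / y : Kˣ) : K) * χ (y : K) = χ (x : K) := by
      rw [← map_mul, ← Units.val_mul, div_mul_cancel]
    rw [hxy] at h2
    have h3 : χ (y : K) ≠ 0 := (y.isUnit.map χ).ne_zero
    exact mul_right_cancel₀ h3 (by rw [h2, one_mul])
  obtain ⟨j, rfl⟩ := hord k h1
  rw [← hk, ← pow_mul, mul_right_comm, hn, pow_mul, pow_card_eq_one', one_pow]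

theorem charSum_stepanov {K : Type*} [Field K] [Fintype K] (χ : MulChar K ℂ) (hd : 2 ≤ orderOf χ)
    (H : K[X]) (hH : KCond (orderOf χ) H) : ∃ C : ℝ, ∀ (k : ℕ) (_ : 0 < k) (L : Type) [Field L]
    [Fintype L] [Algebra K L] (_ : Module.finrank K L = 2 * k),
    ‖∑ z : L, χ (Algebra.norm K (aeval z H))‖ ≤ C * (Fintype.card K : ℝ) ^ k := by
  classical
  set d := orderOf χ with hdd
  set h := H.natDegree with hh
  set C := 2 * (d * h + 2) + h + 2 with hC
  refine ⟨(d * C + h : ℕ), ?_⟩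
  intro k hk L _ _ _ hfr
  obtain ⟨p, hpK⟩ := CharP.exists K
  obtain ⟨n, hp, hcard⟩ := FiniteField.card K p
  haveI : Fact p.Prime := ⟨hp⟩
  haveI : CharP L p := charP_of_injective_algebraMap (algebraMap K L).injective p
  set Q := Fintype.card K with hQ
  set s := Q ^ k with hs
  have hQ1 : 1 < Q := Fintype.one_lt_card
  have hs' : s = p ^ ((n : ℕ) * k) := by rw [hs, hcard, pow_mul]
  have hL : Fintype.card L = s ^ 2 := by
    rw [Module.card_eq_pow_finrank (K := K), hfr, hs, ← pow_mul, mul_comm]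
  have hcu : Nat.card Kˣ = Q - 1 := by
    rw [Nat.card_units, Nat.card_eq_fintype_card]
  have hdQ : d ∣ Q - 1 := by
    rw [← hcu]
    apply orderOf_dvd_of_pow_eq_one
    ext a
    rw [MulChar.pow_apply_coe, MulChar.one_apply_coe, ← map_pow, ← Units.val_pow_eq_pow_val,
      pow_card_eq_one', Units.val_one, map_one]
  obtain ⟨n₀, hn₀⟩ := hdQ
  have hQs : Q - 1 ∣ s - 1 := by
    simpa using Nat.sub_dvd_pow_sub_pow Q 1 k
  obtain ⟨r, hr⟩ := hQs
  have hs1 : 1 ≤ s := Nat.one_le_pow _ _ (by omega)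
  set t := n₀ * r with ht
  have hdt : s = d * t + 1 := by
    have : s - 1 = d * t := by rw [hr, hn₀, ht, mul_assoc]
    omega
  -- primitive root
  obtain ⟨ζ, hζ⟩ : ∃ ζ : L, IsPrimitiveRoot ζ d := by
    obtain ⟨g, hg⟩ := IsCyclic.exists_ofOrder_eq_natCard (α := Kˣ)
    have hg' : IsPrimitiveRoot g (Q - 1) := by
      rw [← hcu, ← hg]; exact IsPrimitiveRoot.orderOf g
    have h2 := hg'.pow (by omega) (show Q - 1 = n₀ * d by rw [hn₀, mul_comm])
    have h3 := h2.map_of_injective (f := Units.coeHom K) Units.val_injective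
    exact ⟨_, h3.map_of_injective (f := algebraMap K L) (algebraMap K L).injective⟩
  set HL := H.map (algebraMap K L) with hHL
  have hHL' : KCond d HL := hH.map _
  have hexp : expand L s HL = HL ^ s := by
    rw [hHL, ← map_expand, hs, hQ, expand_pow_card, Polynomial.map_pow]
  have hdeg : HL.natDegree = h := natDegree_map _
  have hstep := fun u hu => stepanov_bound hs' hL hd hdt hζ HL hHL' hexp u hu
  rw [hdeg, ← hC] at hstep
  have haev : ∀ z : L, aeval z H = eval z HL := fun z => by
    rw [hHL, eval_map_algebraMap]
  have hnorm : ∀ w : L, algebraMap K L (Algebra.norm K w) ^ n₀ = w ^ (t * (s + 1)) := by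
    intro w
    rw [FiniteField.algebraMap_norm_eq_pow, ← pow_mul]
    congr 1
    rw [Nat.card_eq_fintype_card, Nat.card_eq_fintype_card, hL, ← hQ]
    have e3 : s ^ 2 - 1 = (Q - 1) * (r * (s + 1)) := by
      have : s ^ 2 - 1 = (s + 1) * (s - 1) := by
        simpa using Nat.sq_sub_sq s 1
      rw [this, hr]; ring
    rw [e3, Nat.mul_div_cancel_left _ (by omega), ht]; ring
  let V : Finset ℂ := nthRootsFinset d (1 : ℂ)
  let Nv : ℂ → ℕ := fun v => (Finset.univ.filter fun z : L => χ (Algebra.norm K (aeval z H)) = v).card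
  have hNv : ∀ v ∈ V, d * Nv v ≤ s ^ 2 + d * C * s := by
    intro v hv
    have hv' : v ≠ 0 := by
      rintro rfl
      rw [mem_nthRootsFinset (by omega)] at hv
      rw [zero_pow (by omega)] at hv
      exact zero_ne_one hv
    by_cases he : Nv v = 0
    · rw [he]; simp
    obtain ⟨z₀, hz₀⟩ := Finset.card_pos.1 (Nat.pos_of_ne_zero he)
    rw [Finset.mem_filter] at hz₀
    have hnz : ∀ z : L, χ (Algebra.norm K (aeval z H)) = v → Algebra.norm K (aeval z H) ≠ 0 := by
      intro z hz h0
      rw [h0, MulChar.map_zero] at hz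
      exact hv' hz.symm
    have hz00 : eval z₀ HL ≠ 0 := by
      rw [← haev]
      exact Algebra.norm_ne_zero_iff.1 (hnz z₀ hz₀.2)
    refine le_trans (Nat.mul_le_mul_left d ?_) (hstep (eval z₀ HL ^ (t * (s + 1))) (pow_ne_zero _ hz00))
    apply Finset.card_le_card
    intro z hz
    rw [Finset.mem_filter] at hz ⊢
    refine ⟨Finset.mem_univ _, ?_⟩
    rw [← haev, ← haev, ← hnorm, ← hnorm, ← map_pow (algebraMap K L), ← map_pow (algebraMap K L)]
    congr 1
    exact mulChar_generator χ _ _ (hnz z hz.2) (hnz z₀ hz₀.2) (hz.2.trans hz₀.2.symm) n₀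
      (by rw [hcu, hn₀])
  have hmemV : ∀ z : L, eval z HL ≠ 0 → χ (Algebra.norm K (aeval z H)) ∈ V := by
    intro z hz
    rw [← haev] at hz
    have hz' := (Algebra.norm_ne_zero_iff (R := K)).2 hz
    rw [mem_nthRootsFinset (by omega), ← MulChar.pow_apply' _ (by omega), hdd, pow_orderOf_eq_one,
      MulChar.one_apply hz'.isUnit]
  have hz0 : ∀ z : L, eval z HL = 0 → χ (Algebra.norm K (aeval z H)) = 0 := by
    intro z hz
    rw [haev, hz]
    haveI : FiniteDimensional K L := Module.finite_of_finrank_pos (by omega)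
    rw [Algebra.norm_zero, MulChar.map_zero]
  let Z := (Finset.univ.filter fun z : L => eval z HL ≠ 0)
  let Z0 := (Finset.univ.filter fun z : L => eval z HL = 0)
  have hZ0 : Z0.card ≤ h := by
    rw [← hdeg]
    refine card_le_degree_of_subset_roots ?_
    intro z hz
    rw [Finset.mem_val, Finset.mem_filter] at hz
    rw [mem_roots hHL'.1]
    exact hz.2
  have hfib : ∀ v ∈ V, (Z.filter fun z => χ (Algebra.norm K (aeval z H)) = v).card = Nv v := by
    intro v hv
    congr 1
    ext z
    simp only [Finset.mem_filter, Finset.mem_univ, true_and, Z, and_iff_right_iff_imp]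
    intro hz h0
    rw [hz0 z h0] at hz
    rw [← hz, mem_nthRootsFinset (by omega), zero_pow (by omega)] at hv
    exact zero_ne_one hv
  have hsumN : ∑ v ∈ V, Nv v = Z.card := by
    rw [Finset.card_eq_sum_card_fiberwise (f := fun z => χ (Algebra.norm K (aeval z H))) (t := V)]
    · exact Finset.sum_congr rfl fun v hv => (hfib v hv).symm
    · intro z hz
      exact hmemV z (Finset.mem_filter.1 hz).2
  have hS : ∑ z : L, χ (Algebra.norm K (aeval z H)) = ∑ v ∈ V, (Nv v : ℂ) * v := by
    have : ∑ z : L, χ (Algebra.norm K (aeval z H)) = ∑ z ∈ Z, χ (Algebra.norm K (aeval z H)) := by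
      symm
      apply Finset.sum_subset (Finset.subset_univ _)
      intro z _ hz
      apply hz0
      simpa [Z] using hz
    rw [this, ← Finset.sum_fiberwise_of_maps_to (t := V) (g := fun z => χ (Algebra.norm K (aeval z H)))]
    · refine Finset.sum_congr rfl fun v hv => ?_
      rw [← hfib v hv, Finset.sum_congr rfl (g := fun _ => v), Finset.sum_const, nsmul_eq_mul]
      intro z hz
      exact (Finset.mem_filter.1 hz).2
    · intro z hz
      exact hmemV z (Finset.mem_filter.1 hz).2
  have hprimC : IsPrimitiveRoot (Complex.exp (2 * Real.pi * Complex.I / d)) d :=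
    Complex.isPrimitiveRoot_exp d (by omega)
  have hV0 : ∑ v ∈ V, v = 0 := by
    set ω := Complex.exp (2 * Real.pi * Complex.I / d)
    have h1 : ∑ v ∈ V, v = ∑ v ∈ V, ω * v := by
      symm
      refine Finset.sum_bij (fun v _ => ω * v) ?_ ?_ ?_ (fun _ _ => rfl)
      · intro v hv
        rw [mem_nthRootsFinset (by omega)] at hv ⊢
        rw [mul_pow, hv, hprimC.pow_eq_one, one_mul]
      · intro v _ w _ hvw
        exact mul_left_cancel₀ (hprimC.ne_zero (by omega)) hvw
      · intro v hv
        refine ⟨ω⁻¹ * v, ?_, mul_inv_cancel_left₀ (hprimC.ne_zero (by omega)) v⟩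
        rw [mem_nthRootsFinset (by omega)] at hv ⊢
        rw [mul_pow, hv, inv_pow, hprimC.pow_eq_one, inv_one, one_mul]
    rw [← Finset.mul_sum] at h1
    have h2 : ω ≠ 1 := hprimC.ne_one (by omega)
    have h3 : (ω - 1) * ∑ v ∈ V, v = 0 := by rw [sub_mul, one_mul, ← h1, sub_self]
    exact (mul_eq_zero.1 h3).resolve_left (sub_ne_zero.2 h2)
  have hVc : V.card = d := hprimC.card_nthRootsFinset
  have hVn : ∀ v ∈ V, ‖v‖ = 1 := by
    intro v hv
    rw [mem_nthRootsFinset (by omega)] at hv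
    exact Complex.norm_eq_one_of_pow_eq_one hv (by omega)
  have hZc : Z.card + Z0.card = s ^ 2 := by
    rw [← hL, ← Finset.card_univ, add_comm]
    exact Finset.card_filter_add_card_filter_not _
  have hdS : (d : ℂ) * ∑ z : L, χ (Algebra.norm K (aeval z H)) =
      - ∑ v ∈ V, ((s ^ 2 + d * C * s - d * Nv v : ℝ) : ℂ) * v := by
    rw [hS, Finset.mul_sum]
    push_cast
    simp_rw [sub_mul, Finset.sum_sub_distrib]
    rw [← Finset.mul_sum (f := fun v : ℂ => v), hV0, mul_zero, zero_sub, neg_neg]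
    exact Finset.sum_congr rfl fun v hv => by ring
  have hfin : (d : ℝ) * ‖∑ z : L, χ (Algebra.norm K (aeval z H))‖ ≤ d * (s ^ 2 + d * C * s) - d * Z.card := by
    have e1 : (d : ℝ) * ‖∑ z : L, χ (Algebra.norm K (aeval z H))‖ =
      ‖(d : ℂ) * ∑ z : L, χ (Algebra.norm K (aeval z H))‖ := by
      rw [norm_mul, Complex.norm_natCast]
    rw [e1, hdS, norm_neg]
    refine (norm_sum_le _ _).trans ?_
    rw [← hsumN, Nat.cast_sum]
    have : (d : ℝ) * (s ^ 2 + d * C * s) = ∑ v ∈ V, ((s : ℝ) ^ 2 + d * C * s) := by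
      rw [Finset.sum_const, hVc, nsmul_eq_mul]
    rw [this, Finset.mul_sum, ← Finset.sum_sub_distrib]
    apply Finset.sum_le_sum
    intro v hv
    rw [norm_mul, hVn v hv, mul_one, Complex.norm_real, Real.norm_of_nonneg]
    have := hNv v hv
    have : ((d * Nv v : ℕ) : ℝ) ≤ ((s ^ 2 + d * C * s : ℕ) : ℝ) := by exact_mod_cast this
    push_cast at this
    linarith
  have hdpos : (0 : ℝ) < d := by exact_mod_cast (by omega : 0 < d)
  have hZr : (Z.card : ℝ) + Z0.card = s ^ 2 := by exact_mod_cast hZc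
  have hZ0r : (Z0.card : ℝ) ≤ h := by exact_mod_cast hZ0
  have hs1r : (1 : ℝ) ≤ s := by exact_mod_cast hs1
  have e2 : (Q : ℝ) ^ k = s := by rw [hs]; push_cast; rfl
  rw [e2]
  push_cast
  have h8 : (h : ℝ) ≤ h * s := le_mul_of_one_le_right (by positivity) hs1r
  refine le_of_mul_le_mul_left ?_ hdpos
  nlinarith


theorem power_sum_bound {ι : Type*} [Fintype ι] (z : ι → ℂ) (C R : ℝ) (hR : 0 < R)
    (h : ∀ k : ℕ, 0 < k → ‖∑ i, z i ^ k‖ ≤ C * R ^ k) (i₀ : ι) : ‖z i₀‖ ≤ R := by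
  by_contra! hlt
  have : ∃ u : ι → ℂ, ∀ i, ‖u i‖ = 1 ∧ z i = ‖z i‖ * u i := by
    refine ⟨fun i => if z i = 0 then 1 else z i / ‖z i‖, fun i => ?_⟩
    by_cases hi : z i = 0
    · simp [hi]
    · have : (‖z i‖ : ℂ) ≠ 0 := by simpa using hi
      simp only [hi, if_false]
      constructor
      · simp [hi]
      · field_simp
  obtain ⟨u, hu⟩ := this
  have hb : ∀ n : ℕ, (fun i => u i ^ n) ∈ Metric.closedBall (0 : ι → ℂ) 1 := by
    intro n
    rw [mem_closedBall_zero_iff, pi_norm_le_iff_of_nonneg zero_le_one]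
    intro i
    rw [norm_pow, (hu i).1, one_pow]
  obtain ⟨a, -, φ, hφ, hlim⟩ := tendsto_subseq_of_bounded Metric.isBounded_closedBall hb
  have hc := hlim.cauchySeq
  rw [Metric.cauchySeq_iff'] at hc
  obtain ⟨N, hN⟩ := hc (1/2) (by norm_num)
  have hge : ∀ j, N < j → ‖z i₀‖ ^ (φ j - φ N) ≤ 2 * (C * R ^ (φ j - φ N)) := by
    intro j hj
    set n := φ j - φ N with hn
    have hlt' := hφ hj
    have hre : ∀ i, 1/2 ≤ (u i ^ n).re := by
      intro i
      have h1 := lt_of_le_of_lt (dist_le_pi_dist _ _ i) (hN j hj.le)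
      simp only [Function.comp] at h1
      rw [dist_eq_norm] at h1
      have h2 : u i ^ φ j - u i ^ φ N = u i ^ φ N * (u i ^ n - 1) := by
        rw [mul_sub, ← pow_add, mul_one]; congr 2; omega
      rw [h2, norm_mul, norm_pow, (hu i).1, one_pow, one_mul] at h1
      have h3 := (Complex.abs_re_le_norm (u i ^ n - 1)).trans h1.le
      rw [abs_le] at h3
      simp at h3
      linarith
    have h4 : (∑ i, z i ^ n).re = ∑ i, ‖z i‖ ^ n * (u i ^ n).re := by
      rw [Complex.re_sum]
      refine Finset.sum_congr rfl fun i _ => ?_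
      conv_lhs => rw [(hu i).2, mul_pow, ← Complex.ofReal_pow, Complex.re_ofReal_mul]
    have h5 : ‖z i₀‖ ^ n * (1/2) ≤ ∑ i, ‖z i‖ ^ n * (u i ^ n).re := by
      refine le_trans (mul_le_mul_of_nonneg_left (hre i₀) (by positivity)) ?_
      exact Finset.single_le_sum (f := fun i => ‖z i‖ ^ n * (u i ^ n).re)
        (fun i _ => mul_nonneg (by positivity) (by linarith [hre i])) (Finset.mem_univ i₀)
    have h6 := (Complex.re_le_norm _).trans (h n (by omega))
    rw [h4] at h6
    linarith
  have hq : 1 < ‖z i₀‖ / R := by rwa [one_lt_div hR]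
  obtain ⟨M, hM⟩ := pow_unbounded_of_one_lt (2 * C) hq
  have h7 := hge (N + M + 1) (by omega)
  have h8 : M ≤ φ (N + M + 1) - φ N := by
    have := hφ.add_le_nat (M + 1) N
    have e : M + 1 + N = N + M + 1 := by omega
    rw [e] at this; omega
  have h9 : (‖z i₀‖ / R) ^ (φ (N + M + 1) - φ N) ≤ 2 * C := by
    rw [div_pow, div_le_iff₀ (by positivity)]
    linarith
  have := pow_le_pow_right₀ hq.le h8
  linarith


section LF
variable (K : Type*) [Field K] [Fintype K]

theorem finite_natDegree_le (n : ℕ) : {h : K[X] | h.natDegree ≤ n}.Finite := by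
  have : Finite (degreeLT K (n + 1)) := Finite.of_equiv _ (degreeLTEquiv K (n + 1)).symm.toEquiv
  refine Set.Finite.subset (Set.toFinite ((degreeLT K (n + 1) : Submodule K K[X]) : Set K[X])) ?_
  intro h hh
  simp only [SetLike.mem_coe, mem_degreeLT]
  exact lt_of_le_of_lt (degree_le_natDegree) (by exact_mod_cast Nat.lt_succ_of_le hh)

/-- Monic polynomials of degree `n`. -/
noncomputable def monics (n : ℕ) : Finset K[X] :=
  ((finite_natDegree_le K n).subset (t := {h : K[X] | h.Monic ∧ h.natDegree = n})
    (fun _ h => h.2.le)).toFinset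

/-- Monic irreducible polynomials of degree at most `n`. -/
noncomputable def irrs (n : ℕ) : Finset K[X] :=
  ((finite_natDegree_le K n).subset
    (t := {h : K[X] | h.Monic ∧ Irreducible h ∧ h.natDegree ≤ n}) (fun _ h => h.2.2)).toFinset

variable {K}

theorem mem_monics {n : ℕ} {h : K[X]} : h ∈ monics K n ↔ h.Monic ∧ h.natDegree = n := by
  simp [monics]

theorem mem_irrs {n : ℕ} {h : K[X]} :
    h ∈ irrs K n ↔ h.Monic ∧ Irreducible h ∧ h.natDegree ≤ n := by
  simp [irrs]

open Classical in
theorem deg_count {n : ℕ} {h : K[X]} (hh : h ∈ monics K n) :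
    n = ∑ P ∈ irrs K n, ∑ j ∈ Finset.Icc 1 n, if P ^ j ∣ h then P.natDegree else 0 := by
  obtain ⟨hm, hn⟩ := mem_monics.1 hh
  have h0 := hm.ne_zero
  set s := UniqueFactorizationMonoid.normalizedFactors h with hs
  have hprod : s.prod = h := by
    rw [UniqueFactorizationMonoid.prod_normalizedFactors_eq h0, hm.normalize_eq_self]
  have hmem : ∀ P, P ∈ s → P ∈ irrs K n := by
    intro P hP
    have h1 := UniqueFactorizationMonoid.irreducible_of_normalized_factor P hP
    have h2 := UniqueFactorizationMonoid.normalize_normalized_factor P hP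
    have h3 := UniqueFactorizationMonoid.dvd_of_mem_normalizedFactors hP
    refine mem_irrs.2 ⟨?_, h1, hn ▸ natDegree_le_of_dvd h3 h0⟩
    rw [← h2]; exact monic_normalize h1.ne_zero
  have hdeg : n = (s.map natDegree).sum := by
    rw [← hn]
    conv_lhs => rw [← hprod]
    apply natDegree_multiset_prod
    rw [hs]
    exact UniqueFactorizationMonoid.zero_notMem_normalizedFactors h
  have hdeg2 : n = ∑ P ∈ irrs K n, s.count P * P.natDegree := by
    conv_lhs => rw [hdeg, Finset.sum_multiset_map_count]
    simp only [smul_eq_mul]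
    apply Finset.sum_subset
    · intro P hP
      exact hmem P (Multiset.mem_toFinset.1 hP)
    · intro P _ hP
      rw [Multiset.mem_toFinset] at hP
      rw [Multiset.count_eq_zero_of_notMem hP, zero_mul]
  conv_lhs => rw [hdeg2]
  refine Finset.sum_congr rfl fun P hP => ?_
  obtain ⟨hPm, hPi, hPd⟩ := mem_irrs.1 hP
  have hiff : ∀ j, P ^ j ∣ h ↔ j ≤ s.count P := by
    intro j
    have h5 := UniqueFactorizationMonoid.emultiplicity_eq_count_normalizedFactors hPi h0
    rw [hPm.normalize_eq_self] at h5
    rw [pow_dvd_iff_le_emultiplicity, h5, hs]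
    exact_mod_cast Iff.rfl
  have hle : s.count P ≤ n := by
    have : P.natDegree * s.count P ≤ n := by
      rw [mul_comm, hdeg2]
      exact Finset.single_le_sum (f := fun P => s.count P * P.natDegree) (fun _ _ => Nat.zero_le _) hP
    have h2 := hPi.natDegree_pos
    nlinarith
  simp only [hiff]
  rw [← Finset.sum_filter, Finset.sum_const, smul_eq_mul]
  congr 1
  have : Finset.filter (fun j => j ≤ s.count P) (Finset.Icc 1 n) = Finset.Icc 1 (s.count P) := by
    ext j; simp; omega
  rw [this, Nat.card_Icc]; omega

/-- Sum of `lam` over monics of degree `n`. -/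
noncomputable def cSum (lam : K[X] → ℂ) (n : ℕ) : ℂ := ∑ h ∈ monics K n, lam h

open Classical in
/-- Prime power sums. -/
noncomputable def sSum (lam : K[X] → ℂ) (k : ℕ) : ℂ :=
  ∑ P ∈ irrs K k, if P.natDegree ∣ k then P.natDegree * lam P ^ (k / P.natDegree) else 0

theorem lam_pow (lam : K[X] → ℂ) (h1 : lam 1 = 1)
    (hmul : ∀ g h : K[X], g.Monic → h.Monic → lam (g * h) = lam g * lam h) (P : K[X])
    (hP : P.Monic) (j : ℕ) : lam (P ^ j) = lam P ^ j := by
  induction j with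
  | zero => simp [h1]
  | succ j ih => rw [pow_succ, hmul _ _ (hP.pow j) hP, ih, pow_succ]

open Classical in
theorem sum_dvd (lam : K[X] → ℂ) (h1 : lam 1 = 1)
    (hmul : ∀ g h : K[X], g.Monic → h.Monic → lam (g * h) = lam g * lam h) (P : K[X])
    (hP : P.Monic) (j n : ℕ) : ∑ h ∈ monics K n, (if P ^ j ∣ h then lam h else 0) =
      if j * P.natDegree ≤ n then lam P ^ j * cSum lam (n - j * P.natDegree) else 0 := by
  have hPj := hP.pow j
  have hd : (P ^ j).natDegree = j * P.natDegree := hP.natDegree_pow j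
  split_ifs with hle
  · rw [← Finset.sum_filter, cSum, Finset.mul_sum]
    symm
    refine Finset.sum_bij (fun h _ => P ^ j * h) ?_ ?_ ?_ ?_
    · intro h hh
      obtain ⟨hm, hn⟩ := mem_monics.1 hh
      rw [Finset.mem_filter, mem_monics]
      refine ⟨⟨hPj.mul hm, ?_⟩, dvd_mul_right _ _⟩
      rw [hPj.natDegree_mul hm, hd, hn]; omega
    · intro a _ b _ hab
      exact mul_left_cancel₀ hPj.ne_zero hab
    · intro h hh
      rw [Finset.mem_filter, mem_monics] at hh
      obtain ⟨⟨hm, hn⟩, g, rfl⟩ := hh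
      have hg := hPj.of_mul_monic_left hm
      refine ⟨g, mem_monics.2 ⟨hg, ?_⟩, rfl⟩
      rw [hPj.natDegree_mul hg, hd] at hn
      omega
    · intro h hh
      rw [hmul _ _ hPj (mem_monics.1 hh).1, lam_pow lam h1 hmul P hP]
  · apply Finset.sum_eq_zero
    intro h hh
    obtain ⟨hm, hn⟩ := mem_monics.1 hh
    rw [if_neg]
    intro hdvd
    have := natDegree_le_of_dvd hdvd hm.ne_zero
    omega

open Classical in
theorem newton_rec (lam : K[X] → ℂ) (h1 : lam 1 = 1)
    (hmul : ∀ g h : K[X], g.Monic → h.Monic → lam (g * h) = lam g * lam h) (n : ℕ) :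
    n * cSum lam n = ∑ k ∈ Finset.Icc 1 n, sSum lam k * cSum lam (n - k) := by
  have e1 : n * cSum lam n = ∑ P ∈ irrs K n, ∑ j ∈ Finset.Icc 1 n,
      P.natDegree * (if j * P.natDegree ≤ n then lam P ^ j * cSum lam (n - j * P.natDegree) else 0) := by
    rw [cSum, Finset.mul_sum]
    have : ∀ h ∈ monics K n, (n : ℂ) * lam h = ∑ P ∈ irrs K n, ∑ j ∈ Finset.Icc 1 n,
        P.natDegree * (if P ^ j ∣ h then lam h else 0) := by
      intro h hh
      conv_lhs => rw [deg_count hh]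
      push_cast
      rw [Finset.sum_mul]
      refine Finset.sum_congr rfl fun P _ => ?_
      rw [Finset.sum_mul]
      refine Finset.sum_congr rfl fun j _ => ?_
      split_ifs <;> simp
    rw [Finset.sum_congr rfl this, Finset.sum_comm]
    refine Finset.sum_congr rfl fun P hP => ?_
    rw [Finset.sum_comm]
    refine Finset.sum_congr rfl fun j _ => ?_
    rw [← Finset.mul_sum, sum_dvd lam h1 hmul P (mem_irrs.1 hP).1]
  have e2 : ∀ k ∈ Finset.Icc 1 n, sSum lam k * cSum lam (n - k) = ∑ P ∈ irrs K n,
      if P.natDegree ∣ k then P.natDegree * (lam P ^ (k / P.natDegree) * cSum lam (n - k)) else 0 := by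
    intro k hk
    rw [Finset.mem_Icc] at hk
    rw [sSum, Finset.sum_mul]
    rw [Finset.sum_subset (s₁ := irrs K k) (s₂ := irrs K n)]
    · refine Finset.sum_congr rfl fun P _ => ?_
      split_ifs
      · ring
      · simp
    · intro P hP
      rw [mem_irrs] at hP ⊢
      exact ⟨hP.1, hP.2.1, hP.2.2.trans hk.2⟩
    · intro P hP hP'
      rw [if_neg, zero_mul]
      intro hdvd
      rw [mem_irrs] at hP hP'
      exact hP' ⟨hP.1, hP.2.1, Nat.le_of_dvd hk.1 hdvd⟩
  rw [e1, Finset.sum_congr rfl e2, Finset.sum_comm (s := Finset.Icc 1 n)]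
  refine Finset.sum_congr rfl fun P hP => ?_
  have hD := (mem_irrs.1 hP).2.1.natDegree_pos
  simp only [mul_ite, mul_zero]
  rw [← Finset.sum_filter, ← Finset.sum_filter]
  refine Finset.sum_bij (fun j _ => j * P.natDegree) ?_ ?_ ?_ ?_
  · intro j hj
    rw [Finset.mem_filter, Finset.mem_Icc] at hj ⊢
    exact ⟨⟨Nat.mul_pos hj.1.1 hD, hj.2⟩, dvd_mul_left _ _⟩
  · intro a _ b _ hab
    exact Nat.eq_of_mul_eq_mul_right hD hab
  · intro k hk
    rw [Finset.mem_filter, Finset.mem_Icc] at hk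
    obtain ⟨⟨h3, h4⟩, j, rfl⟩ := hk
    refine ⟨j, ?_, mul_comm _ _⟩
    rw [Finset.mem_filter, Finset.mem_Icc, mul_comm j]
    refine ⟨⟨Nat.pos_of_mul_pos_left h3, le_trans ?_ h4⟩, h4⟩
    exact Nat.le_mul_of_pos_left _ hD
  · intro j _
    rw [Nat.mul_div_cancel _ hD]

end LF

theorem newton_solve (c S : ℕ → ℂ) (h0 : c 0 = 1) (hc : ∀ n, 4 ≤ n → c n = 0)
    (hrec : ∀ n : ℕ, n * c n = ∑ k ∈ Finset.Icc 1 n, S k * c (n - k)) :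
    ∃ ω : Fin 3 → ℂ, ∀ k, 0 < k → S k = - ∑ i, ω i ^ k := by
  obtain ⟨x, y, z, h1, h2, h3⟩ : ∃ x y z : ℂ, c 1 = -(x + y + z) ∧ c 2 = x * y + y * z + x * z ∧
      c 3 = -(x * y * z) := by
    set p : ℂ[X] := X ^ 3 + (C (c 1) * X ^ 2 + C (c 2) * X + C (c 3)) with hp
    have hdeg : p.natDegree = 3 := by rw [hp]; compute_degree!
    have hpm : p.Monic := by rw [hp]; monicity!
    have hsp := IsAlgClosed.splits p
    have hcard := hsp.natDegree_eq_card_roots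
    rw [hdeg] at hcard
    obtain ⟨x, y, z, hr⟩ := Multiset.card_eq_three.1 hcard.symm
    have hpr := hsp.eq_prod_roots_of_monic hpm
    rw [hr] at hpr
    simp only [Multiset.insert_eq_cons, Multiset.map_cons, Multiset.map_singleton,
      Multiset.prod_cons, Multiset.prod_singleton] at hpr
    have hex : (X - C x) * ((X - C y) * (X - C z)) = X ^ 3 + (C (-(x + y + z)) * X ^ 2 +
        C (x * y + y * z + x * z) * X + C (-(x * y * z))) := by
      simp only [C_neg, C_add, C_mul]; ring
    rw [hex, hp] at hpr
    refine ⟨x, y, z, ?_⟩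
    generalize -(x + y + z) = a₁ at hpr ⊢
    generalize x * y + y * z + x * z = a₂ at hpr ⊢
    generalize -(x * y * z) = a₃ at hpr ⊢
    refine ⟨?_, ?_, ?_⟩
    · simpa [coeff_X, coeff_C] using congrArg (fun q => coeff q 2) hpr
    · simpa [coeff_X, coeff_C] using congrArg (fun q => coeff q 1) hpr
    · simpa [coeff_X, coeff_C] using congrArg (fun q => coeff q 0) hpr
  refine ⟨![x, y, z], ?_⟩
  simp only [Fin.sum_univ_three, Matrix.cons_val_zero, Matrix.cons_val_one, Matrix.cons_val]
  intro k
  induction k using Nat.strong_induction_on with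
  | _ k ih =>
    intro hk
    have hr := hrec k
    rcases (by omega : k = 1 ∨ k = 2 ∨ k = 3 ∨ 4 ≤ k) with rfl | rfl | rfl | h4
    · simp [h0, h1] at hr
      rw [← hr]; ring
    · have i1 := ih 1 (by omega) (by omega)
      simp [Finset.sum_Icc_succ_top, h0, h1, h2, i1] at hr
      linear_combination -hr
    · have i1 := ih 1 (by omega) (by omega)
      have i2 := ih 2 (by omega) (by omega)
      simp [Finset.sum_Icc_succ_top, h0, h1, h2, h3, i1, i2] at hr
      linear_combination -hr
    · obtain ⟨j, rfl⟩ : ∃ j, k = j + 4 := ⟨k - 4, by omega⟩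
      have i1 := ih (j + 1) (by omega) (by omega)
      have i2 := ih (j + 2) (by omega) (by omega)
      have i3 := ih (j + 3) (by omega) (by omega)
      rw [hc _ (by omega), mul_zero, Finset.sum_Icc_succ_top (by omega),
        Finset.sum_Icc_succ_top (by omega), Finset.sum_Icc_succ_top (by omega),
        Finset.sum_Icc_succ_top (by omega), Finset.sum_eq_zero] at hr
      · have a1 : j + 4 - (j + 1) = 3 := by omega
        have a2 : j + 4 - (j + 1 + 1) = 2 := by omega
        have a3 : j + 4 - (j + 1 + 1 + 1) = 1 := by omega
        have a4 : j + 4 - (j + 1 + 1 + 1 + 1) = 0 := by omega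
        simp only [a1, a2, a3, a4, h0, h1, h2, h3] at hr
        simp only [add_assoc, Nat.reduceAdd, i1, i2, i3] at hr
        linear_combination -hr
      · intro i hi
        rw [Finset.mem_Icc] at hi
        rw [hc _ (by omega), mul_zero]


section
open IntermediateField

theorem norm_aeval_eq {K L E : Type*} [Field K] [Finite K] [Field L] [Algebra K L]
    [FiniteDimensional K L] [Field E] [Algebra K E] [IsAlgClosed E] (x : L) (G : K[X]) :
    algebraMap K E (Algebra.norm K (aeval x G)) =
      (((minpoly K x).aroots E).map (fun y => aeval y G)).prod ^ Module.finrank K⟮x⟯ L := by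
  classical
  set w : K⟮x⟯ := aeval (AdjoinSimple.gen K x) G with hw
  have h1 : aeval x G = algebraMap K⟮x⟯ L w := by
    rw [hw, ← aeval_algebraMap_apply, AdjoinSimple.algebraMap_gen]
  have h2 : Algebra.norm K (aeval x G) = Algebra.norm K w ^ Module.finrank K⟮x⟯ L := by
    rw [h1, ← Algebra.norm_norm (S := K⟮x⟯), Algebra.norm_algebraMap, map_pow]
  rw [h2, map_pow, Algebra.norm_eq_prod_embeddings K E w]
  congr 1
  have hx : IsIntegral K x := .of_finite K x
  let pb := adjoin.powerBasis hx
  have hgen : pb.gen = AdjoinSimple.gen K x := adjoin.powerBasis_gen hx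
  have hmin : minpoly K pb.gen = minpoly K x := by rw [hgen, minpoly_gen]
  have hsep : (minpoly K x).Separable := Algebra.IsSeparable.isSeparable K x
  rw [Fintype.prod_equiv pb.liftEquiv' (fun σ => σ w) (fun y => aeval (y : E) G)]
  · rw [Finset.prod_mem_multiset _ _ (fun y : E => aeval y G), Finset.prod_eq_multiset_prod,
      Multiset.toFinset_val, Multiset.dedup_eq_self.mpr]
    · rw [hmin]
    · rw [hmin]; exact nodup_roots (.map hsep)
    · intro x; rfl
  · intro σ
    rw [PowerBasis.liftEquiv'_apply_coe, hgen, hw, ← aeval_algHom_apply]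

theorem finrank_adjoin_div {K L : Type*} [Field K] [Field L] [Algebra K L]
    [FiniteDimensional K L] (x : L) :
    Module.finrank K⟮x⟯ L = Module.finrank K L / (minpoly K x).natDegree := by
  have hx : IsIntegral K x := .of_finite K x
  rw [← Module.finrank_mul_finrank K K⟮x⟯ L, adjoin.finrank hx,
    Nat.mul_div_cancel_left _ (minpoly.natDegree_pos hx)]

theorem sSum_eq {K L : Type*} [Field K] [Fintype K] [Field L] [Fintype L] [Algebra K L] {k : ℕ}
    (hk : Module.finrank K L = k) (hk0 : 0 < k) (lam : K[X] → ℂ) :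
    sSum lam k = ∑ x : L, lam (minpoly K x) ^ (k / (minpoly K x).natDegree) := by
  classical
  have : FiniteDimensional K L := Module.finite_of_finrank_pos (by omega)
  rw [sSum, ← Finset.sum_filter]
  rw [← Finset.sum_fiberwise_of_maps_to (g := fun x : L => minpoly K x)
    (t := (irrs K k).filter fun P => P.natDegree ∣ k)]
  · refine Finset.sum_congr rfl fun P hP => ?_
    rw [Finset.mem_filter, mem_irrs] at hP
    obtain ⟨⟨hPm, hPi, hPd⟩, hdvd⟩ := hP
    rw [Finset.sum_congr rfl (g := fun _ => lam P ^ (k / P.natDegree))]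
    · rw [Finset.sum_const, nsmul_eq_mul]
      congr 2
      have hcardL : Fintype.card L = Nat.card K ^ k := by
        rw [Module.card_eq_pow_finrank (K := K), hk, Nat.card_eq_fintype_card]
      have hfil : (Finset.univ.filter fun x : L => minpoly K x = P) =
          (P.map (algebraMap K L)).roots.toFinset := by
        ext x
        rw [Finset.mem_filter, Multiset.mem_toFinset, mem_roots (map_monic_ne_zero hPm), IsRoot.def,
          eval_map_algebraMap]
        constructor
        · rintro ⟨-, rfl⟩
          exact minpoly.aeval K x
        · intro hx
          exact ⟨Finset.mem_univ _, (minpoly.eq_of_irreducible_of_monic hPi hx hPm).symm⟩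
      rw [hfil]
      have hdv := map_dvd (mapRingHom (algebraMap K L))
        ((hPi.natDegree_dvd_iff_dvd_X_pow_card_pow_sub_X).1 hdvd)
      rw [← hcardL] at hdv
      simp only [coe_mapRingHom, Polynomial.map_sub, Polynomial.map_pow, map_X] at hdv
      have hne : (X ^ Fintype.card L - X : L[X]) ≠ 0 :=
        FiniteField.X_pow_card_sub_X_ne_zero L Fintype.one_lt_card
      have hspl : (X ^ Fintype.card L - X : L[X]).Splits := by
        rw [splits_iff_card_roots, FiniteField.roots_X_pow_card_sub_X,
          FiniteField.X_pow_card_sub_X_natDegree_eq L Fintype.one_lt_card]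
        rfl
      have hs := hspl.of_dvd hne hdv
      have hsep : P.Separable := PerfectField.separable_of_irreducible hPi
      rw [Multiset.toFinset_card_of_nodup (nodup_roots hsep.map), ← hs.natDegree_eq_card_roots,
        natDegree_map]
    · intro x hx
      rw [(Finset.mem_filter.1 hx).2]
  · intro x _
    have hx : IsIntegral K x := .of_finite K x
    have hd : (minpoly K x).natDegree ∣ k := by
      rw [← hk, ← Module.finrank_mul_finrank K K⟮x⟯ L, adjoin.finrank hx]
      exact dvd_mul_right _ _
    rw [Finset.mem_filter, mem_irrs]
    exact ⟨⟨minpoly.monic hx, minpoly.irreducible hx, Nat.le_of_dvd hk0 hd⟩, hd⟩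
end

section quad
variable {K : Type*} [Field K]

/-- The norm of `h` modulo the monic quadratic `X^2 + b X + c`. -/
noncomputable def nrm (b c : K) (h : K[X]) : K :=
  let r := h %ₘ (X ^ 2 + C b * X + C c)
  r.coeff 0 ^ 2 - b * r.coeff 0 * r.coeff 1 + c * r.coeff 1 ^ 2

theorem quad_monic (b c : K) : (X ^ 2 + C b * X + C c : K[X]).Monic := by monicity!
theorem quad_natDegree (b c : K) : (X ^ 2 + C b * X + C c : K[X]).natDegree = 2 := by
  compute_degree!

theorem quad_roots (b c : K) : ∃ y₁ y₂ : AlgebraicClosure K,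
    (X ^ 2 + C b * X + C c : K[X]).map (algebraMap K (AlgebraicClosure K)) =
      (X - C y₁) * (X - C y₂) := by
  set p := (X ^ 2 + C b * X + C c : K[X]).map (algebraMap K (AlgebraicClosure K))
  have hm : p.Monic := (quad_monic b c).map _
  have hsp := IsAlgClosed.splits p
  have hcard := hsp.natDegree_eq_card_roots
  rw [natDegree_map, quad_natDegree] at hcard
  obtain ⟨x, y, hr⟩ := Multiset.card_eq_two.1 hcard.symm
  refine ⟨x, y, ?_⟩
  have hpr := hsp.eq_prod_roots_of_monic hm
  rw [hr] at hpr
  simpa using hpr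

theorem nrm_eq {E : Type*} [Field E] [Algebra K E] (b c : K) (y₁ y₂ : E)
    (hf : (X ^ 2 + C b * X + C c : K[X]).map (algebraMap K E) = (X - C y₁) * (X - C y₂))
    (h : K[X]) : algebraMap K E (nrm b c h) = aeval y₁ h * aeval y₂ h := by
  set f := (X ^ 2 + C b * X + C c : K[X]) with hfdef
  have hy : ∀ y, (y = y₁ ∨ y = y₂) → aeval y f = 0 := by
    intro y hy
    rw [← eval_map_algebraMap, hf]
    rcases hy with rfl | rfl <;> simp
  set r := h %ₘ f with hr
  have hev : ∀ y, (y = y₁ ∨ y = y₂) → aeval y h =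
      algebraMap K E (r.coeff 1) * y + algebraMap K E (r.coeff 0) := by
    intro y hyy
    have h1 : r.natDegree < 2 := by
      have := natDegree_modByMonic_lt h (quad_monic b c) (by
        intro h1
        have := quad_natDegree b c
        rw [h1] at this; simp at this)
      rwa [quad_natDegree] at this
    rw [← modByMonic_add_div h f, map_add, map_mul, hy y hyy, zero_mul, add_zero, ← hr]
    conv_lhs => rw [eq_X_add_C_of_natDegree_le_one (by omega : r.natDegree ≤ 1)]
    simp
  have hb : algebraMap K E b = -(y₁ + y₂) := by
    have := congrArg (fun p => coeff p 1) hf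
    have e : (X - C y₁) * (X - C y₂) = X ^ 2 + C (-(y₁ + y₂)) * X + C (y₁ * y₂) := by
      simp only [C_neg, C_add, C_mul]; ring
    rw [e] at this
    generalize -(y₁ + y₂) = a at this ⊢
    simpa [hfdef, coeff_X, coeff_C] using this
  have hc : algebraMap K E c = y₁ * y₂ := by
    have := congrArg (fun p => coeff p 0) hf
    simpa [hfdef, mul_coeff_zero] using this
  rw [hev y₁ (Or.inl rfl), hev y₂ (Or.inr rfl)]
  simp only [nrm, ← hfdef, ← hr, map_add, map_sub, map_mul, map_pow, hb, hc]
  ring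

theorem nrm_mul (b c : K) (g h : K[X]) : nrm b c (g * h) = nrm b c g * nrm b c h := by
  obtain ⟨y₁, y₂, hf⟩ := quad_roots b c
  apply (algebraMap K (AlgebraicClosure K)).injective
  rw [map_mul, nrm_eq b c y₁ y₂ hf, nrm_eq b c y₁ y₂ hf, nrm_eq b c y₁ y₂ hf, map_mul, map_mul]
  ring

theorem nrm_add_mul (b c : K) (g h : K[X]) :
    nrm b c (g + (X ^ 2 + C b * X + C c) * h) = nrm b c g := by
  simp only [nrm]
  rw [add_modByMonic, (modByMonic_eq_zero_iff_dvd (quad_monic b c)).2 (dvd_mul_right _ _), add_zero]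

theorem nrm_one (b c : K) : nrm b c 1 = 1 := by
  obtain ⟨y₁, y₂, hf⟩ := quad_roots b c
  apply (algebraMap K (AlgebraicClosure K)).injective
  rw [nrm_eq b c y₁ y₂ hf]; simp

theorem nrm_coprime (b c : K) (h : K[X]) (hn : nrm b c h ≠ 0) :
    IsCoprime h (X ^ 2 + C b * X + C c) := by
  obtain ⟨y₁, y₂, hf⟩ := quad_roots b c
  have h1 : algebraMap K (AlgebraicClosure K) (nrm b c h) ≠ 0 := by simpa using hn
  rw [nrm_eq b c y₁ y₂ hf] at h1
  rw [← isCoprime_map (algebraMap K (AlgebraicClosure K)), hf]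
  have : ∀ y : AlgebraicClosure K, aeval y h ≠ 0 →
      IsCoprime (h.map (algebraMap K (AlgebraicClosure K))) (X - C y) := by
    intro y hy
    refine IsCoprime.symm ((irreducible_X_sub_C y).coprime_iff_not_dvd.2 ?_)
    rw [dvd_iff_isRoot, IsRoot.def, eval_map_algebraMap]
    exact hy
  exact (this _ (left_ne_zero_of_mul h1)).mul_right (this _ (right_ne_zero_of_mul h1))

theorem nrm_minpoly {L : Type*} [Field L] [Finite K] [Algebra K L] [FiniteDimensional K L] (b c : K)
    (x : L) : Algebra.norm K (aeval x (X ^ 2 + C b * X + C c : K[X])) =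
      nrm b c (minpoly K x) ^ (Module.finrank K L / (minpoly K x).natDegree) := by
  obtain ⟨y₁, y₂, hf⟩ := quad_roots b c
  apply (algebraMap K (AlgebraicClosure K)).injective
  rw [norm_aeval_eq, map_pow, nrm_eq b c y₁ y₂ hf, finrank_adjoin_div]
  congr 1
  have hx : IsIntegral K x := .of_finite K x
  set P := minpoly K x
  have hsp := IsAlgClosed.splits (P.map (algebraMap K (AlgebraicClosure K)))
  have hP : ∀ y, aeval y P = (-1) ^ P.natDegree * ((P.aroots (AlgebraicClosure K)).map (fun z => z - y)).prod := by
    intro y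
    rw [← eval_map_algebraMap, hsp.eq_prod_roots_of_monic ((minpoly.monic hx).map _),
      eval_multiset_prod, Multiset.map_map]
    have : P.natDegree = Multiset.card (P.aroots (AlgebraicClosure K)) := by
      rw [aroots, ← hsp.natDegree_eq_card_roots, natDegree_map]
    rw [this, ← Multiset.card_map (fun z => z - y) (P.aroots (AlgebraicClosure K)),
      ← Multiset.prod_map_neg, Multiset.map_map]
    simp [Function.comp_def, aroots]
  have h3 : ∀ z : AlgebraicClosure K, aeval z (X ^ 2 + C b * X + C c : K[X]) = (z - y₁) * (z - y₂) := by
    intro z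
    rw [← eval_map_algebraMap, hf]; simp
  simp only [h3]
  rw [Multiset.prod_map_mul, hP, hP, mul_mul_mul_comm, ← mul_pow]
  simp
end quad


section lamsec
variable {K : Type*} [Field K]

/-- The multiplicative weight on monic polynomials. -/
noncomputable def lam (χ₁ χ₂ : MulChar K ℂ) (ψ : AddChar K ℂ) (b c : K) (h : K[X]) : ℂ :=
  χ₁ ((-1) ^ h.natDegree * h.coeff 0) * χ₂ (nrm b c h) * ψ (-h.nextCoeff)

/-- The character sum over an extension `L`. -/
noncomputable def chSum (χ₁ χ₂ : MulChar K ℂ) (ψ : AddChar K ℂ) (b c : K) (L : Type*) [Field L]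
    [Fintype L] [Algebra K L] : ℂ :=
  ∑ x : L, χ₁ (Algebra.norm K x) * χ₂ (Algebra.norm K (aeval x (X ^ 2 + C b * X + C c : K[X]))) *
    ψ (Algebra.trace K L x)

variable (χ₁ χ₂ : MulChar K ℂ) (ψ : AddChar K ℂ) (b c : K)

theorem lam_one : lam χ₁ χ₂ ψ b c 1 = 1 := by
  have h : (1 : K[X]).nextCoeff = 0 := by rw [← C_1]; exact nextCoeff_C_eq_zero 1
  simp [lam, nrm_one, h]

theorem lam_mul (g h : K[X]) (hg : g.Monic) (hh : h.Monic) :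
    lam χ₁ χ₂ ψ b c (g * h) = lam χ₁ χ₂ ψ b c g * lam χ₁ χ₂ ψ b c h := by
  have e : (-1 : K) ^ (g.natDegree + h.natDegree) * (g.coeff 0 * h.coeff 0) =
      ((-1) ^ g.natDegree * g.coeff 0) * ((-1) ^ h.natDegree * h.coeff 0) := by ring
  have e2 : -(g.nextCoeff + h.nextCoeff) = -g.nextCoeff + -h.nextCoeff := by ring
  simp only [lam, nrm_mul, hg.nextCoeff_mul hh, hg.natDegree_mul hh, mul_coeff_zero]
  rw [e, e2, map_mul χ₁ (_ * _) (_ * _), map_mul χ₂, AddChar.map_add_eq_mul]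
  ring

open IntermediateField in
theorem lam_minpoly [Finite K] {L : Type*} [Field L] [Algebra K L] [FiniteDimensional K L] (x : L) :
    lam χ₁ χ₂ ψ b c (minpoly K x) ^ (Module.finrank K L / (minpoly K x).natDegree) =
      χ₁ (Algebra.norm K x) * χ₂ (Algebra.norm K (aeval x (X ^ 2 + C b * X + C c : K[X]))) *
        ψ (Algebra.trace K L x) := by
  have hx : IsIntegral K x := .of_finite K x
  have h1 : Algebra.norm K x = ((-1) ^ (minpoly K x).natDegree * (minpoly K x).coeff 0) ^
      (Module.finrank K L / (minpoly K x).natDegree) := by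
    rw [Algebra.norm_eq_norm_adjoin, finrank_adjoin_div]
    congr 1
    have := Algebra.PowerBasis.norm_gen_eq_coeff_zero_minpoly (adjoin.powerBasis hx)
    rw [adjoin.powerBasis_gen, minpoly_gen, adjoin.powerBasis_dim] at this
    exact this
  rw [nrm_minpoly, trace_eq_finrank_mul_minpoly_nextCoeff, h1, finrank_adjoin_div, lam, map_pow,
    map_pow, ← nsmul_eq_mul, AddChar.map_nsmul_eq_pow]
  ring

theorem sSum_lam [Fintype K] {L : Type*} [Field L] [Fintype L] [Algebra K L] {k : ℕ}
    (hk : Module.finrank K L = k) (hk0 : 0 < k) :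
    sSum (lam χ₁ χ₂ ψ b c) k = chSum χ₁ χ₂ ψ b c L := by
  have : FiniteDimensional K L := Module.finite_of_finrank_pos (by omega)
  rw [sSum_eq hk hk0, chSum]
  refine Finset.sum_congr rfl fun x _ => ?_
  rw [← lam_minpoly, hk]

theorem sum_perm {α : Type*} (s : Finset α) (T : α → α) (hT : ∀ a ∈ s, T a ∈ s)
    (hinj : ∀ a ∈ s, ∀ b ∈ s, T a = T b → a = b) (g : α → ℂ) : ∑ a ∈ s, g (T a) = ∑ a ∈ s, g a := by
  classical
  have hi : Set.InjOn T s := fun a ha b hb => hinj a ha b hb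
  have : s.image T = s := by
    apply Finset.eq_of_subset_of_card_le
    · intro y hy
      obtain ⟨a, ha, rfl⟩ := Finset.mem_image.1 hy
      exact hT a ha
    · rw [Finset.card_image_of_injOn hi]
  conv_rhs => rw [← this]
  rw [Finset.sum_image hi]

theorem cSum_zero [Fintype K] : cSum (lam χ₁ χ₂ ψ b c) 0 = 1 := by
  have : monics K 0 = {1} := by
    ext h
    rw [mem_monics, Finset.mem_singleton]
    constructor
    · rintro ⟨h1, h2⟩
      exact h1.natDegree_eq_zero.1 h2
    · rintro rfl; simp
  rw [cSum, this, Finset.sum_singleton, lam_one]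

theorem cSum_vanish_add [Fintype K] (hψ : ψ ≠ 1) (n : ℕ) (hn : 4 ≤ n) :
    cSum (lam χ₁ χ₂ ψ b c) n = 0 := by
  obtain ⟨t, ht⟩ := AddChar.ne_one_iff.1 hψ
  obtain ⟨j, rfl⟩ : ∃ j, n = j + 4 := ⟨n - 4, by omega⟩
  set f : K[X] := X ^ 2 + C b * X + C c with hf
  have hfm : f.Monic := quad_monic b c
  set D : K[X] := f * (C (-t) * X ^ (j + 1)) with hD
  have hDdeg : D.natDegree ≤ j + 3 := by
    rw [hD]
    refine natDegree_mul_le.trans ?_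
    rw [hf, quad_natDegree]
    have := natDegree_C_mul_X_pow_le (-t) (j + 1)
    omega
  have hDd : D.degree < (j + 4 : ℕ) :=
    lt_of_le_of_lt degree_le_natDegree (by exact_mod_cast Nat.lt_succ_of_le hDdeg)
  have hDc : D.coeff (j + 3) = -t := by
    rw [hD, ← mul_assoc, show j + 3 = 2 + (j + 1) by omega, coeff_mul_X_pow, coeff_mul_C]
    have : f.coeff 2 = 1 := by
      have := hfm.coeff_natDegree
      rwa [quad_natDegree] at this
    rw [this, one_mul]
  have hD0 : D.coeff 0 = 0 := by
    rw [hD, mul_coeff_zero, mul_coeff_zero]; simp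
  have hT : ∀ h ∈ monics K (j + 4), h + D ∈ monics K (j + 4) := by
    intro h hh
    obtain ⟨hm, hd⟩ := mem_monics.1 hh
    have h1 : D.degree < h.degree := by rw [degree_eq_natDegree hm.ne_zero, hd]; exact hDd
    refine mem_monics.2 ⟨hm.add_of_left h1, ?_⟩
    rw [natDegree_add_eq_left_of_degree_lt h1, hd]
  have hlam : ∀ h ∈ monics K (j + 4), lam χ₁ χ₂ ψ b c (h + D) = ψ t * lam χ₁ χ₂ ψ b c h := by
    intro h hh
    obtain ⟨hm, hd⟩ := mem_monics.1 hh
    obtain ⟨hm', hd'⟩ := mem_monics.1 (hT h hh)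
    have hnc : ∀ g : K[X], g.natDegree = j + 4 → g.nextCoeff = g.coeff (j + 3) := by
      intro g hg
      rw [nextCoeff_of_natDegree_pos (by omega), hg]; rfl
    simp only [lam]
    rw [hnc _ hd, hnc _ hd', hd, hd', coeff_add, coeff_add, hD0, add_zero, hDc, hD, nrm_add_mul,
      neg_add, neg_neg, AddChar.map_add_eq_mul]
    ring
  have key := sum_perm (monics K (j + 4)) (fun h => h + D) hT
    (fun a _ b _ hab => add_right_cancel hab) (lam χ₁ χ₂ ψ b c)
  rw [Finset.sum_congr rfl hlam, ← Finset.mul_sum] at key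
  have : (ψ t - 1) * cSum (lam χ₁ χ₂ ψ b c) (j + 4) = 0 := by
    rw [sub_mul, one_mul, cSum, key, sub_self]
  exact (mul_eq_zero.1 this).resolve_left (sub_ne_zero.2 ht)

theorem cSum_vanish_mul [Fintype K] (u : K[X]) (hu0 : χ₁ (u.coeff 0) * χ₂ (nrm b c u) ≠ 0)
    (hu1 : χ₁ (u.coeff 0) * χ₂ (nrm b c u) ≠ 1) (n : ℕ) (hn : 4 ≤ n) :
    cSum (lam χ₁ χ₂ 1 b c) n = 0 := by
  set f : K[X] := X ^ 2 + C b * X + C c with hf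
  have hfm : f.Monic := quad_monic b c
  have hXf : (f * X).Monic := hfm.mul monic_X
  have hXfd : (f * X).natDegree = 3 := by
    rw [hfm.natDegree_mul monic_X, quad_natDegree, natDegree_X]
  have hcop : IsCoprime u (f * X) := by
    refine IsCoprime.mul_right (nrm_coprime b c u ?_) ?_
    · intro h0; rw [h0, MulChar.map_zero, mul_zero] at hu0; exact hu0 rfl
    · refine IsCoprime.symm (irreducible_X.coprime_iff_not_dvd.2 ?_)
      rw [X_dvd_iff]
      intro h0; rw [h0, MulChar.map_zero, zero_mul] at hu0; exact hu0 rfl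
  set R : K[X] → K[X] := fun h => ((u - 1) * h) %ₘ (f * X) with hR
  have hRd : ∀ h, (R h).degree < (n : ℕ) := by
    intro h
    refine (degree_modByMonic_lt _ hXf).trans_le ?_
    rw [degree_eq_natDegree hXf.ne_zero, hXfd]
    exact_mod_cast (by omega : 3 ≤ n)
  have hT : ∀ h ∈ monics K n, h + R h ∈ monics K n := by
    intro h hh
    obtain ⟨hm, hd⟩ := mem_monics.1 hh
    have h1 : (R h).degree < h.degree := by rw [degree_eq_natDegree hm.ne_zero, hd]; exact hRd h
    refine mem_monics.2 ⟨hm.add_of_left h1, ?_⟩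
    rw [natDegree_add_eq_left_of_degree_lt h1, hd]
  have hcongr : ∀ h, h + R h = u * h + f * (X * -((u - 1) * h /ₘ (f * X))) := by
    intro h
    have := modByMonic_add_div ((u - 1) * h) (f * X)
    simp only [hR]
    linear_combination this
  have hlam : ∀ h ∈ monics K n, lam χ₁ χ₂ 1 b c (h + R h) =
      (χ₁ (u.coeff 0) * χ₂ (nrm b c u)) * lam χ₁ χ₂ 1 b c h := by
    intro h hh
    obtain ⟨hm, hd⟩ := mem_monics.1 hh
    obtain ⟨hm', hd'⟩ := mem_monics.1 (hT h hh)
    simp only [lam]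
    rw [hd, hd', hcongr, nrm_add_mul, nrm_mul]
    have : (u * h + f * (X * -((u - 1) * h /ₘ (f * X)))).coeff 0 = u.coeff 0 * h.coeff 0 := by
      simp [mul_coeff_zero]
    rw [this, map_mul, map_mul, map_mul, map_mul, AddChar.one_apply, AddChar.one_apply]
    ring
  have hinj : ∀ g ∈ monics K n, ∀ h ∈ monics K n, g + R g = h + R h → g = h := by
    intro g _ h _ hgh
    have h2 : f * X ∣ u * (g - h) := by
      have h3 := hcongr g
      have h4 := hcongr h
      refine ⟨((u - 1) * g /ₘ (f * X)) - ((u - 1) * h /ₘ (f * X)), ?_⟩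
      linear_combination hgh - h3 + h4
    have h5 : f * X ∣ g - h := hcop.symm.dvd_of_dvd_mul_left h2
    have h6 : R g = R h := by
      rw [← sub_eq_zero]
      simp only [hR]
      rw [← sub_modByMonic, ← mul_sub, modByMonic_eq_zero_iff_dvd hXf]
      exact h5.mul_left _
    rw [h6] at hgh
    exact add_right_cancel hgh
  have key := sum_perm (monics K n) (fun h => h + R h) hT hinj (lam χ₁ χ₂ 1 b c)
  rw [Finset.sum_congr rfl hlam, ← Finset.mul_sum] at key
  have : (χ₁ (u.coeff 0) * χ₂ (nrm b c u) - 1) * cSum (lam χ₁ χ₂ 1 b c) n = 0 := by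
    rw [sub_mul, one_mul, cSum, key, sub_self]
  exact (mul_eq_zero.1 this).resolve_left (sub_ne_zero.2 hu1)

theorem chSum_large [Fintype K] (htriv : ∀ u : K[X], χ₁ (u.coeff 0) * χ₂ (nrm b c u) = 0 ∨
    χ₁ (u.coeff 0) * χ₂ (nrm b c u) = 1) {L : Type*} [Field L] [Fintype L] [Algebra K L] :
    (Fintype.card L : ℝ) - 3 ≤ ‖chSum χ₁ χ₂ 1 b c L‖ := by
  classical
  have : FiniteDimensional K L := .of_finite
  set k := Module.finrank K L with hk
  set f : K[X] := X ^ 2 + C b * X + C c with hf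
  have hfm : f.Monic := quad_monic b c
  have hXf : (f * X).Monic := hfm.mul monic_X
  have hXfd : (f * X).natDegree = 3 := by
    rw [hfm.natDegree_mul monic_X, quad_natDegree, natDegree_X]
  set ε : ℂ := χ₁ ((-1) ^ k) with hε
  have hεn : ‖ε‖ = 1 := by
    have h1 : ε ^ 2 = 1 := by
      rw [hε, ← map_pow, ← pow_mul, mul_comm, pow_mul]; simp
    exact Complex.norm_eq_one_of_pow_eq_one h1 two_ne_zero
  let Z := Finset.univ.filter fun x : L => aeval x (f * X) ≠ 0
  let Z0 := Finset.univ.filter fun x : L => aeval x (f * X) = 0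
  have hZ0 : Z0.card ≤ 3 := by
    rw [← hXfd, ← natDegree_map (algebraMap K L)]
    refine card_le_degree_of_subset_roots ?_
    intro z hz
    rw [Finset.mem_val, Finset.mem_filter] at hz
    rw [mem_roots (map_monic_ne_zero hXf), IsRoot.def, eval_map_algebraMap]
    exact hz.2
  have hZc : Z0.card + Z.card = Fintype.card L := by
    rw [← Finset.card_univ]
    exact Finset.card_filter_add_card_filter_not _
  have hsum : chSum χ₁ χ₂ 1 b c L = Z.card * ε := by
    rw [chSum, ← Finset.sum_subset (Finset.subset_univ Z)]
    · rw [← nsmul_eq_mul, ← Finset.sum_const]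
      refine Finset.sum_congr rfl fun x hx => ?_
      have hx := (Finset.mem_filter.1 hx).2
      rw [map_mul, aeval_X] at hx
      have hne : χ₁ (Algebra.norm K x) * χ₂ (Algebra.norm K (aeval x f)) *
          (1 : AddChar K ℂ) (Algebra.trace K L x) ≠ 0 := by
        rw [AddChar.one_apply, mul_one]
        have h1 : IsUnit (Algebra.norm K x) :=
          (Algebra.norm_ne_zero_iff.2 (right_ne_zero_of_mul hx)).isUnit
        have h2 : IsUnit (Algebra.norm K (aeval x f)) :=
          (Algebra.norm_ne_zero_iff.2 (left_ne_zero_of_mul hx)).isUnit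
        exact mul_ne_zero (h1.map χ₁).ne_zero (h2.map χ₂).ne_zero
      rw [← lam_minpoly] at hne ⊢
      set P := minpoly K x with hP
      have hx : IsIntegral K x := .of_finite K x
      have hd : P.natDegree ∣ k := by
        rw [hk, ← Module.finrank_mul_finrank K (IntermediateField.adjoin K {x}) L,
          IntermediateField.adjoin.finrank hx]
        exact dvd_mul_right _ _
      have hr : k / P.natDegree ≠ 0 := by
        have : 0 < k := Module.finrank_pos
        exact (Nat.div_pos (Nat.le_of_dvd this hd) (minpoly.natDegree_pos hx)).ne'
      have hne' : lam χ₁ χ₂ 1 b c P ≠ 0 := fun h0 => hne (by rw [h0, zero_pow hr])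
      have hlam : lam χ₁ χ₂ 1 b c P = χ₁ ((-1) ^ P.natDegree) * (χ₁ (P.coeff 0) * χ₂ (nrm b c P)) := by
        rw [lam, AddChar.one_apply, map_mul]; ring
      rcases htriv P with h | h
      · rw [hlam, h, mul_zero] at hne'; exact absurd rfl hne'
      · rw [hlam, h, mul_one, ← map_pow, ← pow_mul, Nat.mul_div_cancel' hd, hε]
    · intro x _ hx
      have hx : aeval x (f * X) = 0 := by
        by_contra h
        exact hx (Finset.mem_filter.2 ⟨Finset.mem_univ _, h⟩)
      rw [map_mul, aeval_X] at hx
      rcases mul_eq_zero.1 hx with h | h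
      · rw [h, Algebra.norm_zero, MulChar.map_zero]; ring
      · rw [h, Algebra.norm_zero, MulChar.map_zero]; ring
  rw [hsum, norm_mul, hεn, mul_one, Complex.norm_natCast]
  have h1 : (Z0.card : ℝ) + Z.card = Fintype.card L := by exact_mod_cast hZc
  have h2 : (Z0.card : ℝ) ≤ 3 := by exact_mod_cast hZ0
  linarith

theorem exists_extension [Fintype K] (k : ℕ) (hk : 0 < k) : ∃ (L : Type) (_ : Field L)
    (_ : Fintype L) (_ : Algebra K L), Module.finrank K L = k := by
  obtain ⟨p, hpK⟩ := CharP.exists K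
  obtain ⟨n, hp, hcard⟩ := FiniteField.card K p
  have : Fact p.Prime := ⟨hp⟩
  have : NeZero k := ⟨hk.ne'⟩
  exact ⟨FiniteField.Extension K p k, inferInstance, Fintype.ofFinite _, inferInstance,
    FiniteField.finrank_extension K p k⟩

theorem exists_omega [Fintype K] (h : ψ ≠ 1 ∨ (ψ = 1 ∧ ∃ C₀ : ℝ, ∀ (k : ℕ) (_ : 0 < k) (L : Type) [Field L]
    [Fintype L] [Algebra K L] (_ : Module.finrank K L = 2 * k),
    ‖chSum χ₁ χ₂ 1 b c L‖ ≤ C₀ * (Fintype.card K : ℝ) ^ k)) :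
    ∃ ω : Fin 3 → ℂ, ∀ k, 0 < k → sSum (lam χ₁ χ₂ ψ b c) k = - ∑ i, ω i ^ k := by
  refine newton_solve (cSum (lam χ₁ χ₂ ψ b c)) _ (cSum_zero _ _ _ _ _) ?_
    (newton_rec _ (lam_one _ _ _ _ _) (lam_mul _ _ _ _ _))
  intro n hn
  rcases h with h | ⟨rfl, C₀, h⟩
  · exact cSum_vanish_add _ _ _ _ _ h n hn
  by_cases htriv : ∀ u : K[X], χ₁ (u.coeff 0) * χ₂ (nrm b c u) = 0 ∨
    χ₁ (u.coeff 0) * χ₂ (nrm b c u) = 1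
  · exfalso
    have hQ : (2 : ℝ) ≤ Fintype.card K := by exact_mod_cast Fintype.one_lt_card (α := K)
    have hk : ∀ k : ℕ, 0 < k → ((Fintype.card K : ℝ) ^ k) ^ 2 - 3 ≤ C₀ * (Fintype.card K : ℝ) ^ k := by
      intro k hk
      obtain ⟨L, _, _, _, hL⟩ := exists_extension (K := K) (2 * k) (by omega)
      have h1 := chSum_large χ₁ χ₂ b c htriv (L := L)
      have h2 := h k hk L hL
      rw [Module.card_eq_pow_finrank (K := K), hL] at h1
      push_cast at h1
      rw [← pow_mul, mul_comm k 2]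
      linarith
    obtain ⟨M, hM⟩ := pow_unbounded_of_one_lt (|C₀| + 3) (by linarith : (1 : ℝ) < Fintype.card K)
    have h3 := hk (M + 1) (by omega)
    have h4 : (Fintype.card K : ℝ) ^ M ≤ (Fintype.card K : ℝ) ^ (M + 1) :=
      pow_le_pow_right₀ (by linarith) (by omega)
    set y := (Fintype.card K : ℝ) ^ (M + 1)
    have h5 : C₀ ≤ |C₀| := le_abs_self _
    nlinarith [abs_nonneg C₀]
  · push Not at htriv
    obtain ⟨u, hu0, hu1⟩ := htriv
    exact cSum_vanish_mul _ _ _ _ u hu0 hu1 n hn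

end lamsec


theorem KCond.comp {k : Type*} [Field k] {d : ℕ} {H : k[X]} (h : KCond d H) (τ : k[X]) (u : k)
    (hu : u ≠ 0) (hτ : derivative τ = C u) (hdeg : 0 < τ.natDegree) : KCond d (H.comp τ) := by
  refine ⟨?_, fun l hl hld => ?_⟩
  · intro h0
    rcases comp_eq_zero_iff.1 h0 with h1 | ⟨_, h1⟩
    · exact h.1 h1
    · rw [h1, natDegree_C] at hdeg; exact lt_irrefl _ hdeg
  · obtain ⟨A, B, e, h1, h2, h3, h4, h5⟩ := h.2 l hl hld
    have key : ∀ P R : k[X], IsCoprime P R → IsCoprime (P.comp τ) (R.comp τ) := fun P R hPR =>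
      hPR.map (compRingHom τ)
    refine ⟨A.comp τ, B.comp τ, e, by rw [h1]; simp, ?_, ?_, key _ _ h4, h5⟩
    · rw [separable_def, derivative_comp, hτ]
      have := key _ _ h2
      exact (isCoprime_mul_unit_left_right ((isUnit_C).2 hu.isUnit) _ _).2 this
    · rw [natDegree_comp]; exact Nat.mul_pos h3 hdeg

theorem quad_separable {K : Type*} [Field K] (b c : K) (h : b ^ 2 - 4 * c ≠ 0) :
    (X ^ 2 + C b * X + C c : K[X]).Separable := by
  have hd : derivative (X ^ 2 + C b * X + C c : K[X]) = C 2 * X + C b := by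
    simp; norm_num; rfl
  rw [separable_def, hd]
  refine ⟨C (-4 * (b ^ 2 - 4 * c)⁻¹), C ((b ^ 2 - 4 * c)⁻¹) * (C 2 * X + C b), ?_⟩
  have : C ((b ^ 2 - 4 * c)⁻¹) * C (b ^ 2 - 4 * c) = (1 : K[X]) := by
    rw [← C_mul, inv_mul_cancel₀ h, C_1]
  rw [← this]
  have e4 : (C (4 : K)) = (4 : K[X]) := rfl
  have e2 : (C (2 : K)) = (2 : K[X]) := rfl
  simp only [C_mul, C_neg, C_sub, C_pow, e4, e2]
  ring

theorem kcond_quad {K : Type*} [Field K] (b c : K) (h : b ^ 2 - 4 * c ≠ 0) (d i j : ℕ)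
    (hij : ∀ l : ℕ, l.Prime → l ∣ d → ¬ (l ∣ i ∧ l ∣ j)) :
    KCond d (X ^ i * (X ^ 2 + C b * X + C c : K[X]) ^ j) := by
  refine ⟨mul_ne_zero (pow_ne_zero _ X_ne_zero) (pow_ne_zero _ (quad_monic b c).ne_zero), ?_⟩
  intro l hl hld
  have hij := hij l hl hld
  by_cases hc : c = 0
  · subst hc
    have hb : b ≠ 0 := by rintro rfl; simp at h
    have hf : (X ^ 2 + C b * X + C 0 : K[X]) = X * (X + C b) := by simp; ring
    have hcop : IsCoprime (X : K[X]) (X + C b) := by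
      refine ⟨- C b⁻¹, C b⁻¹, ?_⟩
      have : C b⁻¹ * C b = (1 : K[X]) := by rw [← C_mul, inv_mul_cancel₀ hb, C_1]
      rw [← this]; ring
    rw [hf, mul_pow]
    by_cases hj : l ∣ j
    · refine ⟨X, (X + C b) ^ j, i + j, by ring, separable_X, by simp, hcop.pow_right, ?_⟩
      intro h2
      exact hij ⟨(Nat.dvd_add_left hj).1 h2, hj⟩
    · exact ⟨X + C b, X ^ (i + j), j, by ring, separable_X_add_C b, by simp,
        hcop.symm.pow_right, hj⟩
  · have hcop : IsCoprime (X : K[X]) (X ^ 2 + C b * X + C c) := by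
      refine ⟨- C c⁻¹ * (X + C b), C c⁻¹, ?_⟩
      have : C c⁻¹ * C c = (1 : K[X]) := by rw [← C_mul, inv_mul_cancel₀ hc, C_1]
      rw [← this]; ring
    by_cases hj : l ∣ j
    · exact ⟨X, (X ^ 2 + C b * X + C c) ^ j, i, by ring, separable_X, by simp, hcop.pow_right,
        fun h2 => hij ⟨h2, hj⟩⟩
    · exact ⟨X ^ 2 + C b * X + C c, X ^ i, j, by ring, quad_separable b c h,
        by rw [quad_natDegree]; norm_num, hcop.symm.pow_right, hj⟩

theorem exists_gen {K : Type*} [Field K] [Fintype K] (χ₁ χ₂ : MulChar K ℂ)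
    (h : ¬ (χ₁ = 1 ∧ χ₂ = 1)) : ∃ (χ : MulChar K ℂ) (i j : ℕ), 2 ≤ orderOf χ ∧ 0 < i ∧ 0 < j ∧
      χ₁ = χ ^ i ∧ χ₂ = χ ^ j ∧ ∀ l : ℕ, l.Prime → l ∣ orderOf χ → ¬ (l ∣ i ∧ l ∣ j) := by
  have : IsCyclic (MulChar K ℂ) := by
    obtain ⟨e⟩ := MulChar.mulEquiv_units K ℂ
    exact isCyclic_of_surjective e.symm e.symm.surjective
  obtain ⟨⟨χ, hχ⟩, hgen⟩ := IsCyclic.exists_generator (α := Subgroup.closure {χ₁, χ₂})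
  have hfin : ∀ η ∈ Subgroup.closure {χ₁, χ₂}, ∃ n : ℕ, 0 < n ∧ η = χ ^ n := by
    intro η hη
    have h1 : η ∈ Subgroup.zpowers χ := by
      obtain ⟨n, hn⟩ := Subgroup.mem_zpowers_iff.1 (hgen ⟨η, hη⟩)
      exact Subgroup.mem_zpowers_iff.2 ⟨n, by simpa using congrArg Subtype.val hn⟩
    obtain ⟨n, hn⟩ := (mem_powers_iff_mem_zpowers).2 h1
    refine ⟨n + orderOf χ, by have := orderOf_pos χ; omega, ?_⟩
    simp only at hn
    rw [pow_add, pow_orderOf_eq_one, mul_one, hn]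
  obtain ⟨i, hi, hi'⟩ := hfin χ₁ (Subgroup.subset_closure (by simp))
  obtain ⟨j, hj, hj'⟩ := hfin χ₂ (Subgroup.subset_closure (by simp))
  refine ⟨χ, i, j, ?_, hi, hj, hi', hj', ?_⟩
  · by_contra hlt
    have h1 : orderOf χ = 1 := by have := orderOf_pos χ; omega
    rw [orderOf_eq_one_iff] at h1
    subst h1
    exact h ⟨by simpa using hi', by simpa using hj'⟩
  · rintro l hl hld ⟨⟨i', rfl⟩, ⟨j', rfl⟩⟩
    have hle : Subgroup.closure {χ₁, χ₂} ≤ Subgroup.zpowers (χ ^ l) := by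
      rw [Subgroup.closure_le]
      rintro η (rfl | rfl)
      · exact Subgroup.mem_zpowers_iff.2 ⟨i', by rw [hi', pow_mul, zpow_natCast]⟩
      · exact Subgroup.mem_zpowers_iff.2 ⟨j', by rw [hj', pow_mul, zpow_natCast]⟩
    have h1 := orderOf_dvd_of_mem_zpowers (hle hχ)
    rw [orderOf_pow_of_dvd hl.ne_zero hld] at h1
    have h2 := Nat.le_of_dvd (Nat.div_pos (Nat.le_of_dvd (orderOf_pos χ) hld) hl.pos) h1
    have h3 := Nat.div_lt_self (orderOf_pos χ) hl.one_lt
    omega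

theorem chSum_one_eq {K : Type*} [Field K] (χ : MulChar K ℂ) (i j : ℕ) (hi : 0 < i) (hj : 0 < j)
    (b c : K) {L : Type*} [Field L] [Algebra K L] (z : L) :
    χ (Algebra.norm K (aeval z (X ^ i * (X ^ 2 + C b * X + C c : K[X]) ^ j))) =
      (χ ^ i) (Algebra.norm K z) * (χ ^ j) (Algebra.norm K (aeval z (X ^ 2 + C b * X + C c : K[X]))) := by
  rw [MulChar.pow_apply' χ hi.ne', MulChar.pow_apply' χ hj.ne']
  rw [map_mul, map_pow, map_pow, aeval_X, map_mul, map_pow, map_pow, map_mul, map_pow, map_pow]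



theorem exists_AS {K : Type*} [Field K] [Fintype K] (p : ℕ) [Fact p.Prime] [CharP K p]
    (ψ : AddChar K ℂ) (hψ : ψ ≠ 1) : ∃ y₀ : K, y₀ ≠ 0 ∧ ∀ (L : Type) [Field L] [Fintype L]
      [Algebra K L] (z : L), ψ (Algebra.trace K L (algebraMap K L y₀ * (z ^ p - z))) = 1 := by
  letI : Algebra (ZMod p) K := ZMod.algebra K p
  have hp : p.Prime := Fact.out
  have : NeZero p := ⟨hp.ne_zero⟩
  have hζ := Complex.isPrimitiveRoot_exp p hp.ne_zero
  set ζ := Complex.exp (2 * Real.pi * Complex.I / p)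
  set e := AddChar.zmodChar p hζ.pow_eq_one with he
  have he1 : e ≠ 1 := by
    rw [AddChar.zmod_char_ne_one_iff]
    have := AddChar.zmodChar_apply' hζ.pow_eq_one 1
    rw [Nat.cast_one, pow_one] at this
    rw [he, this]
    exact hζ.ne_one hp.one_lt
  set ψ' : AddChar K ℂ := e.compAddMonoidHom (Algebra.trace (ZMod p) K).toAddMonoidHom with hψ'
  have hψ1 : ψ' ≠ 1 := by
    intro h
    apply he1
    ext a
    obtain ⟨y, rfl⟩ := Algebra.trace_surjective (ZMod p) K a
    exact (AddChar.eq_one_iff.1 h) y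
  have hinj : Function.Injective (fun r : K => ψ.mulShift r) :=
    AddChar.to_mulShift_inj_of_isPrimitive (AddChar.IsPrimitive.of_ne_one hψ)
  have hbij : Function.Bijective (fun r : K => ψ.mulShift r) := by
    rw [Fintype.bijective_iff_injective_and_card]
    exact ⟨hinj, AddChar.card_eq.symm⟩
  obtain ⟨y₀, hy⟩ := hbij.2 ψ'
  simp only at hy
  refine ⟨y₀, ?_, ?_⟩
  · rintro rfl
    apply hψ1
    rw [← hy]; simp
  · intro L _ _ _ z
    letI : Algebra (ZMod p) L := ((algebraMap K L).comp (algebraMap (ZMod p) K)).toAlgebra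
    have : IsScalarTower (ZMod p) K L := IsScalarTower.of_algebraMap_eq fun x => rfl
    have : CharP L p := charP_of_injective_algebraMap (algebraMap K L).injective p
    rw [← Algebra.smul_def, map_smul, smul_eq_mul]
    have h1 := congrArg (fun f => f (Algebra.trace K L (z ^ p - z))) hy
    simp only [AddChar.mulShift_apply] at h1
    rw [h1, hψ', AddChar.compAddMonoidHom_apply]
    have h2 : (Algebra.trace (ZMod p) K).toAddMonoidHom (Algebra.trace K L (z ^ p - z)) =
        Algebra.trace (ZMod p) L (z ^ p - z) := Algebra.trace_trace _
    have h3 : Algebra.trace (ZMod p) L (z ^ p) = Algebra.trace (ZMod p) L z := by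
      have := Algebra.trace_eq_of_algEquiv (FiniteField.frobeniusAlgEquiv (ZMod p) L p) z
      rw [← this]
      congr 1
      simp [FiniteField.frobeniusAlgEquiv]
    rw [h2, map_sub, h3, sub_self, AddChar.map_zero_eq_one]

theorem AS_count {K : Type*} [Field K] [Fintype K] (p : ℕ) [Fact p.Prime] [CharP K p]
    (ψ : AddChar K ℂ) (hψ : ψ ≠ 1) (y₀ : K) (hy₀ : y₀ ≠ 0) (L : Type) [Field L] [Fintype L]
    [Algebra K L] (hA : ∀ z : L, ψ (Algebra.trace K L (algebraMap K L y₀ * (z ^ p - z))) = 1)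
    (G : L → ℂ) : ∑ z : L, G (algebraMap K L y₀ * (z ^ p - z)) =
      ∑ n ∈ Finset.range p, ∑ x : L, G x * (ψ ^ n) (Algebra.trace K L x) := by
  classical
  have hp : p.Prime := Fact.out
  have hpow : ψ ^ p = 1 := by
    ext x
    rw [AddChar.pow_apply, ← AddChar.map_nsmul_eq_pow, nsmul_eq_mul, CharP.cast_eq_zero, zero_mul]
    simp
  have hord : orderOf ψ = p := orderOf_eq_prime hpow hψ
  set t : L → L := fun z => algebraMap K L y₀ * (z ^ p - z) with ht
  have hfin : FiniteDimensional K L := Module.Finite.of_finite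
  -- the two counting functions
  set N : L → ℕ := fun x => (Finset.univ.filter fun z => t z = x).card with hN
  set M : L → ℕ := fun x => if ψ (Algebra.trace K L x) = 1 then p else 0 with hM
  have hMsum : ∀ x, (M x : ℂ) = ∑ n ∈ Finset.range p, (ψ ^ n) (Algebra.trace K L x) := by
    intro x
    simp only [AddChar.pow_apply, hM]
    by_cases h : ψ (Algebra.trace K L x) = 1
    · simp [h]
    · rw [if_neg h, Nat.cast_zero, geom_sum_eq h]
      have : ψ (Algebra.trace K L x) ^ p = 1 := by
        rw [← AddChar.pow_apply, hpow, AddChar.one_apply]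
      rw [this, sub_self, zero_div]
  have hle : ∀ x ∈ (Finset.univ : Finset L), N x ≤ M x := by
    intro x _
    by_cases h : ψ (Algebra.trace K L x) = 1
    · simp only [hM, if_pos h]
      set P : L[X] := X ^ p - X - C ((algebraMap K L y₀)⁻¹ * x) with hP
      have hy : algebraMap K L y₀ ≠ 0 := by simpa using hy₀
      have hdeg : P.natDegree = p := by
        rw [hP, sub_sub]
        rw [natDegree_sub_eq_left_of_natDegree_lt]
        · simp
        · rw [natDegree_X_add_C, natDegree_X_pow]; exact hp.one_lt
      have hP0 : P ≠ 0 := by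
        rintro h0; rw [h0, natDegree_zero] at hdeg; exact hp.ne_zero hdeg.symm
      calc N x ≤ P.roots.toFinset.card := by
            apply Finset.card_le_card
            intro z hz
            rw [Finset.mem_filter] at hz
            rw [Multiset.mem_toFinset, mem_roots hP0, IsRoot.def, hP, ← hz.2]
            simp [ht, hy]
        _ ≤ P.roots.card := Multiset.toFinset_card_le _
        _ ≤ p := hdeg ▸ card_roots' P
    · have : N x = 0 := by
        simp only [hN, Finset.card_eq_zero, Finset.filter_eq_empty_iff]
        rintro z - rfl
        exact h (hA z)
      omega
  have hs1 : ∑ x, N x = Fintype.card L := by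
    rw [← Finset.card_univ, Finset.card_eq_sum_card_fiberwise (f := t) (t := Finset.univ)]
    exact fun _ _ => by simp
  have hs2 : ∑ x, M x = Fintype.card L := by
    have : (∑ x, (M x : ℂ)) = Fintype.card L := by
      rw [Finset.sum_congr rfl fun x _ => hMsum x, Finset.sum_comm,
        Finset.sum_eq_single_of_mem 0 (Finset.mem_range.2 hp.pos)]
      · simp
      · intro n hn hn0
        have hne : ψ ^ n ≠ 1 := pow_ne_one_of_lt_orderOf hn0 (by rw [hord]; exact Finset.mem_range.1 hn)
        refine AddChar.sum_eq_zero_of_ne_one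
          (ψ := (ψ ^ n).compAddMonoidHom (Algebra.trace K L).toAddMonoidHom) ?_
        intro h
        apply hne
        ext a
        obtain ⟨y, rfl⟩ := Algebra.trace_surjective K L a
        exact (AddChar.eq_one_iff.1 h) y
    exact_mod_cast this
  have hNM := (Finset.sum_eq_sum_iff_of_le hle).1 (hs1.trans hs2.symm)
  calc ∑ z : L, G (t z) = ∑ x, ∑ z ∈ Finset.univ.filter (fun z => t z = x), G (t z) :=
        (Finset.sum_fiberwise_of_maps_to (fun _ _ => Finset.mem_univ _) _).symm
    _ = ∑ x, (N x : ℂ) * G x := by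
        refine Finset.sum_congr rfl fun x _ => ?_
        rw [Finset.sum_congr rfl (g := fun _ => G x), Finset.sum_const, nsmul_eq_mul]
        intro z hz
        rw [(Finset.mem_filter.1 hz).2]
    _ = ∑ x, ∑ n ∈ Finset.range p, G x * (ψ ^ n) (Algebra.trace K L x) := by
        refine Finset.sum_congr rfl fun x hx => ?_
        rw [hNM x hx, hMsum, mul_comm, Finset.mul_sum]
    _ = _ := Finset.sum_comm


theorem chSum_bound {K : Type*} [Field K] [Fintype K] (χ₁ χ₂ : MulChar K ℂ) (ψ : AddChar K ℂ)
    (b c : K) (hdisc : b ^ 2 - 4 * c ≠ 0) (hne : ¬ (χ₁ = 1 ∧ χ₂ = 1)) :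
    ‖chSum χ₁ χ₂ ψ b c K‖ ≤ 3 * Real.sqrt (Fintype.card K) := by
  obtain ⟨p, hpK⟩ := CharP.exists K
  obtain ⟨_, hp, _⟩ := FiniteField.card K p
  have : Fact p.Prime := ⟨hp⟩
  obtain ⟨χ, i, j, hd, hi, hj, rfl, rfl, hij⟩ := exists_gen χ₁ χ₂ hne
  set f := (X ^ 2 + C b * X + C c : K[X]) with hf
  have hK := kcond_quad b c hdisc (orderOf χ) i j hij
  have hQ : (0 : ℝ) < Fintype.card K := by exact_mod_cast Fintype.card_pos
  obtain ⟨C₀, hC₀⟩ := charSum_stepanov χ hd _ hK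
  have hb0 : ∀ (k : ℕ) (_ : 0 < k) (L : Type) [Field L] [Fintype L] [Algebra K L]
      (_ : Module.finrank K L = 2 * k),
      ‖chSum (χ ^ i) (χ ^ j) 1 b c L‖ ≤ C₀ * (Fintype.card K : ℝ) ^ k := by
    intro k hk L _ _ _ hL
    refine le_of_eq_of_le ?_ (hC₀ k hk L hL)
    congr 1
    refine Finset.sum_congr rfl fun z _ => ?_
    rw [chSum_one_eq χ i j hi hj, AddChar.one_apply, mul_one]
  have hω : ∀ φ : AddChar K ℂ, ∃ ω : Fin 3 → ℂ, ∀ k, 0 < k →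
      sSum (lam (χ ^ i) (χ ^ j) φ b c) k = - ∑ i, ω i ^ k := by
    intro φ
    apply exists_omega
    by_cases h : φ = 1
    · exact Or.inr ⟨h, C₀, hb0⟩
    · exact Or.inl h
  choose ω hω using hω
  have key : ∀ a, ‖ω ψ a ^ 2‖ ≤ Fintype.card K := by
    by_cases hψ : ψ = 1
    · subst hψ
      refine power_sum_bound _ C₀ _ hQ ?_
      intro k hk
      obtain ⟨L, _, _, _, hL⟩ := exists_extension (K := K) (2 * k) (by omega)
      simp only [← pow_mul]
      rw [← norm_neg, ← hω 1 (2 * k) (by omega), sSum_lam _ _ _ _ _ hL (by omega)]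
      exact hb0 k hk L hL
    · obtain ⟨y₀, hy₀, hA⟩ := exists_AS p ψ hψ
      set τ : K[X] := C y₀ * (X ^ p - X) with hτ
      have hdeg : τ.natDegree = p := by
        rw [hτ, natDegree_C_mul hy₀, natDegree_sub_eq_left_of_natDegree_lt]
        · simp
        · rw [natDegree_X, natDegree_X_pow]; exact hp.one_lt
      have hder : derivative τ = C (-y₀) := by
        have hpow : derivative (X ^ p : K[X]) = 0 := by
          rw [derivative_X_pow, CharP.cast_eq_zero, C_0, zero_mul]
        rw [hτ, derivative_C_mul, derivative_sub, hpow, derivative_X, C_neg]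
        ring
      have hK2 := hK.comp τ (-y₀) (neg_ne_zero.2 hy₀) hder (by rw [hdeg]; exact hp.pos)
      obtain ⟨C₁, hC₁⟩ := charSum_stepanov χ hd _ hK2
      intro a
      refine power_sum_bound (ι := Fin p × Fin 3) (fun na => ω (ψ ^ (na.1 : ℕ)) na.2 ^ 2) C₁ _ hQ ?_
        (⟨1, hp.one_lt⟩, a) |> fun h => by simpa using h
      intro k hk
      obtain ⟨L, _, _, _, hL⟩ := exists_extension (K := K) (2 * k) (by omega)
      simp only [← pow_mul]
      rw [Fintype.sum_prod_type, ← norm_neg, ← Finset.sum_neg_distrib]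
      refine le_of_eq_of_le ?_ (hC₁ k hk L hL)
      congr 1
      have h1 := AS_count p ψ hψ y₀ hy₀ L (hA L) (fun x => (χ ^ i) (Algebra.norm K x) *
        (χ ^ j) (Algebra.norm K (aeval x f)))
      have h2 : ∀ z : L, χ (Algebra.norm K (aeval z ((X ^ i * f ^ j).comp τ))) =
          (χ ^ i) (Algebra.norm K (algebraMap K L y₀ * (z ^ p - z))) *
          (χ ^ j) (Algebra.norm K (aeval (algebraMap K L y₀ * (z ^ p - z)) f)) := by
        intro z
        rw [aeval_comp, chSum_one_eq χ i j hi hj]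
        simp [hτ, hf]
      rw [Finset.sum_congr rfl fun z _ => h2 z, h1, Finset.sum_range]
      refine Finset.sum_congr rfl fun n _ => ?_
      simp only
      rw [← hω _ (2 * k) (by omega), sSum_lam _ _ _ _ _ hL (by omega)]
      rfl
  have h1 := sSum_lam (χ ^ i) (χ ^ j) ψ b c (Module.finrank_self K) Nat.one_pos
  rw [← h1, hω ψ 1 Nat.one_pos, norm_neg]
  have key' : ∀ a, ‖ω ψ a‖ ≤ Real.sqrt (Fintype.card K) := fun a => by
    apply Real.le_sqrt_of_sq_le
    rw [← norm_pow]; exact key a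
  calc ‖∑ a, ω ψ a ^ 1‖ ≤ ∑ a, ‖ω ψ a ^ 1‖ := norm_sum_le _ _
    _ ≤ ∑ _a : Fin 3, Real.sqrt (Fintype.card K) :=
        Finset.sum_le_sum fun a _ => by rw [pow_one]; exact key' a
    _ = _ := by simp

/-- The Weil bound used in the sieve. -/
theorem weil_bound {K : Type*} [Field K] [Fintype K] (χ₁ χ₂ : MulChar K ℂ) (ψ : AddChar K ℂ)
    (a b c : K) (ha : a ≠ 0) (hdisc : b ^ 2 - 4 * a * c ≠ 0) (hne : ¬ (χ₁ = 1 ∧ χ₂ = 1)) :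
    ‖∑ x : K, χ₁ x * χ₂ (a * x ^ 2 + b * x + c) * ψ x‖ ≤ 3 * Real.sqrt (Fintype.card K) := by
  have h := chSum_bound χ₁ χ₂ ψ (b / a) (c / a) (by
    intro h0
    apply hdisc
    have : b ^ 2 - 4 * a * c = a ^ 2 * ((b / a) ^ 2 - 4 * (c / a)) := by field_simp
    rw [this, h0, mul_zero]) hne
  have h2 : ∑ x : K, χ₁ x * χ₂ (a * x ^ 2 + b * x + c) * ψ x =
      χ₂ a * chSum χ₁ χ₂ ψ (b / a) (c / a) K := by
    rw [chSum, Finset.mul_sum]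
    refine Finset.sum_congr rfl fun x _ => ?_
    have : a * x ^ 2 + b * x + c = a * (x ^ 2 + b / a * x + c / a) := by field_simp
    rw [this, map_mul]
    simp only [Algebra.norm_self, Algebra.trace_self, MonoidHom.id_apply, LinearMap.id_apply,
      map_add, map_mul, map_pow, aeval_X, aeval_C, Algebra.algebraMap_self, RingHom.id_apply]
    ring
  rw [h2, norm_mul]
  have h3 : ‖χ₂ a‖ ≤ 1 := by
    have : χ₂ a ^ (Fintype.card K - 1) = 1 := by
      rw [← map_pow, FiniteField.pow_card_sub_one_eq_one a ha, map_one]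
    exact (Complex.norm_eq_one_of_pow_eq_one this
      (by have := Fintype.one_lt_card (α := K); omega)).le
  calc _ ≤ 1 * ‖chSum χ₁ χ₂ ψ (b / a) (c / a) K‖ := by gcongr
    _ ≤ _ := by rw [one_mul]; exact h

theorem quad_zero_card {K : Type*} [Field K] [Fintype K] [DecidableEq K] (a b c : K) (ha : a ≠ 0) :
    (Finset.univ.filter fun x : K => x * (a * x ^ 2 + b * x + c) = 0).card ≤ 3 := by
  set P : K[X] := C a * X ^ 3 + C b * X ^ 2 + C c * X + C 0 with hP
  have hdeg : P.natDegree = 3 := natDegree_cubic ha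
  have hP0 : P ≠ 0 := by rintro h; rw [h] at hdeg; simp at hdeg
  calc _ ≤ P.roots.toFinset.card := by
        apply Finset.card_le_card
        intro x hx
        rw [Finset.mem_filter] at hx
        rw [Multiset.mem_toFinset, mem_roots hP0, IsRoot.def, hP]
        simp only [eval_add, eval_mul, eval_C, eval_pow, eval_X]
        linear_combination hx.2
    _ ≤ P.roots.card := Multiset.toFinset_card_le _
    _ ≤ 3 := hdeg ▸ card_roots' P

theorem triv_mul {K : Type*} [Field K] (u v : K) [Decidable (u * v = 0)] :
    (1 : MulChar K ℂ) u * (1 : MulChar K ℂ) v = if u * v = 0 then 0 else 1 := by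
  split_ifs with h
  · rcases mul_eq_zero.1 h with h | h
    · rw [h, MulChar.map_zero, zero_mul]
    · rw [h, MulChar.map_zero, mul_zero]
  · rw [MulChar.one_apply (left_ne_zero_of_mul h).isUnit,
      MulChar.one_apply (right_ne_zero_of_mul h).isUnit, mul_one]

theorem triv_sum {K : Type*} [Field K] [Fintype K] (ψ : AddChar K ℂ)
    (a b c : K) (ha : a ≠ 0) :
    ‖(∑ x : K, (1 : MulChar K ℂ) x * (1 : MulChar K ℂ) (a * x ^ 2 + b * x + c) * ψ x) -
      ∑ x : K, ψ x‖ ≤ 3 := by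
  classical
  rw [← Finset.sum_sub_distrib]
  have : ∀ x : K, (1 : MulChar K ℂ) x * (1 : MulChar K ℂ) (a * x ^ 2 + b * x + c) * ψ x - ψ x =
      if x * (a * x ^ 2 + b * x + c) = 0 then - ψ x else 0 := by
    intro x
    rw [triv_mul]
    split_ifs <;> ring
  rw [Finset.sum_congr rfl fun x _ => this x, ← Finset.sum_filter]
  calc _ ≤ ∑ x ∈ Finset.univ.filter (fun x : K => x * (a * x ^ 2 + b * x + c) = 0), ‖-ψ x‖ :=
        norm_sum_le _ _
    _ = ((Finset.univ.filter fun x : K => x * (a * x ^ 2 + b * x + c) = 0).card : ℝ) := by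
        rw [Finset.sum_congr rfl (g := fun _ => (1 : ℝ))]
        · simp
        · intro x _; rw [norm_neg, AddChar.norm_apply]
    _ ≤ 3 := by exact_mod_cast quad_zero_card a b c ha

theorem weil_all {K : Type*} [Field K] [Fintype K] (χ₁ χ₂ : MulChar K ℂ) (ψ : AddChar K ℂ)
    (a b c : K) (ha : a ≠ 0) (hdisc : b ^ 2 - 4 * a * c ≠ 0)
    (hne : ¬ (χ₁ = 1 ∧ χ₂ = 1 ∧ ψ = 1)) :
    ‖∑ x : K, χ₁ x * χ₂ (a * x ^ 2 + b * x + c) * ψ x‖ ≤ 3 * Real.sqrt (Fintype.card K) := by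
  by_cases h : χ₁ = 1 ∧ χ₂ = 1
  · obtain ⟨rfl, rfl⟩ := h
    have hψ : ψ ≠ 1 := fun h => hne ⟨rfl, rfl, h⟩
    have h1 := triv_sum ψ a b c ha
    rw [AddChar.sum_eq_zero_of_ne_one hψ, sub_zero] at h1
    have h2 : (1 : ℝ) ≤ Real.sqrt (Fintype.card K) := by
      rw [Real.one_le_sqrt]; exact_mod_cast Fintype.card_pos
    linarith
  · exact weil_bound χ₁ χ₂ ψ a b c ha hdisc h


theorem mulChar_prod_apply {K ι : Type*} [Field K] (χ : ι → MulChar K ℂ) (T : Finset ι) (x : K)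
    (hx : x ≠ 0) : (∏ l ∈ T, χ l) x = ∏ l ∈ T, χ l x := by
  classical
  induction T using Finset.induction_on with
  | empty => simp [MulChar.one_apply hx.isUnit]
  | insert l T hl ih => rw [Finset.prod_insert hl, Finset.prod_insert hl, MulChar.mul_apply, ih]

theorem mul_expand {K ι : Type*} [Field K] (χ : ι → MulChar K ℂ) (S : Finset ι) (x : K) :
    (1 : MulChar K ℂ) x * ∏ l ∈ S, (1 - χ l x) =
      ∑ T ∈ S.powerset, (-1) ^ T.card * (∏ l ∈ T, χ l) x := by
  classical
  by_cases hx : x = 0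
  · simp [hx, MulChar.map_zero]
  · rw [MulChar.one_apply (Ne.isUnit hx), one_mul]
    simp only [sub_eq_add_neg]
    rw [Finset.prod_one_add]
    refine Finset.sum_congr rfl fun T _ => ?_
    rw [mulChar_prod_apply χ T x hx, Finset.prod_neg]

theorem addChar_prod_apply {K ι : Type*} [Field K] (ψ : ι → AddChar K ℂ) (T : Finset ι) (x : K) :
    (∏ l ∈ T, ψ l) x = ∏ l ∈ T, ψ l x := by
  classical
  induction T using Finset.induction_on with
  | empty => simp
  | insert l T hl ih => rw [Finset.prod_insert hl, Finset.prod_insert hl, AddChar.mul_apply, ih]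

theorem add_expand {K ι : Type*} [Field K] (ψ : ι → AddChar K ℂ) (S : Finset ι) (x : K) :
    ∏ l ∈ S, (1 - ψ l x) = ∑ T ∈ S.powerset, (-1) ^ T.card * (∏ l ∈ T, ψ l) x := by
  classical
  simp only [sub_eq_add_neg]
  rw [Finset.prod_one_add]
  refine Finset.sum_congr rfl fun T _ => ?_
  rw [addChar_prod_apply, Finset.prod_neg]

theorem sieve {K ι₁ ι₂ ι₃ : Type*} [Field K] [Fintype K] (χ : ι₁ → MulChar K ℂ)
    (χ' : ι₂ → MulChar K ℂ) (ψ : ι₃ → AddChar K ℂ) (S₁ : Finset ι₁) (S₂ : Finset ι₂)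
    (S₃ : Finset ι₃) (h₁ : ∀ T ⊆ S₁, ∏ l ∈ T, χ l = 1 → T = ∅)
    (h₂ : ∀ T ⊆ S₂, ∏ l ∈ T, χ' l = 1 → T = ∅) (h₃ : ∀ T ⊆ S₃, ∏ l ∈ T, ψ l = 1 → T = ∅)
    (a b c : K) (ha : a ≠ 0) (hdisc : b ^ 2 - 4 * a * c ≠ 0)
    (hQ : 3 * 2 ^ S₁.card * 2 ^ S₂.card * 2 ^ S₃.card < Real.sqrt (Fintype.card K)) :
    ∃ x : K, x ≠ 0 ∧ a * x ^ 2 + b * x + c ≠ 0 ∧ (∀ l ∈ S₁, χ l x ≠ 1) ∧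
      (∀ l ∈ S₂, χ' l (a * x ^ 2 + b * x + c) ≠ 1) ∧ ∀ l ∈ S₃, ψ l x ≠ 1 := by
  classical
  by_contra hcon
  push Not at hcon
  set f : K → K := fun x => a * x ^ 2 + b * x + c with hf
  have hzero : ∀ x : K, ((1 : MulChar K ℂ) x * ∏ l ∈ S₁, (1 - χ l x)) *
      ((1 : MulChar K ℂ) (f x) * ∏ l ∈ S₂, (1 - χ' l (f x))) * ∏ l ∈ S₃, (1 - ψ l x) = 0 := by
    intro x
    by_cases hx : x = 0
    · simp [hx, MulChar.map_zero]
    by_cases hfx : f x = 0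
    · simp [hfx, MulChar.map_zero]
    by_cases hs1 : ∀ l ∈ S₁, χ l x ≠ 1
    · by_cases hs2 : ∀ l ∈ S₂, χ' l (f x) ≠ 1
      · obtain ⟨l, hl, hl1⟩ := hcon x hx hfx hs1 hs2
        rw [Finset.prod_eq_zero hl (by rw [hl1, sub_self]), mul_zero]
      · push Not at hs2
        obtain ⟨l, hl, hl1⟩ := hs2
        rw [Finset.prod_eq_zero (s := S₂) hl (by rw [hl1, sub_self])]; ring
    · push Not at hs1
      obtain ⟨l, hl, hl1⟩ := hs1
      rw [Finset.prod_eq_zero (s := S₁) hl (by rw [hl1, sub_self])]; ring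
  set P := S₁.powerset ×ˢ (S₂.powerset ×ˢ S₃.powerset) with hP
  set W : Finset ι₁ × (Finset ι₂ × Finset ι₃) → ℂ := fun t =>
    (-1) ^ t.1.card * (-1) ^ t.2.1.card * (-1) ^ t.2.2.card *
      ∑ x : K, (∏ l ∈ t.1, χ l) x * (∏ l ∈ t.2.1, χ' l) (f x) * (∏ l ∈ t.2.2, ψ l) x with hW
  have htot : ∑ t ∈ P, W t = 0 := by
    rw [← Finset.sum_eq_zero (s := (Finset.univ : Finset K)) fun x _ => hzero x]
    simp only [hW, Finset.mul_sum]
    rw [Finset.sum_comm]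
    refine Finset.sum_congr rfl fun x _ => ?_
    rw [mul_expand, mul_expand, add_expand, hP, Finset.sum_product, Finset.sum_mul, Finset.sum_mul]
    refine Finset.sum_congr rfl fun T₁ _ => ?_
    rw [Finset.sum_product, mul_assoc, Finset.sum_mul_sum, Finset.mul_sum]
    refine Finset.sum_congr rfl fun T₂ _ => ?_
    rw [Finset.mul_sum]
    refine Finset.sum_congr rfl fun T₃ _ => ?_
    ring
  have hmem : (∅, (∅, ∅)) ∈ P := by simp [hP]
  rw [← Finset.add_sum_erase _ _ hmem] at htot
  have hW0 : W (∅, (∅, ∅)) =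
      ∑ x : K, (1 : MulChar K ℂ) x * (1 : MulChar K ℂ) (f x) * (1 : AddChar K ℂ) x := by
    simp [hW]
  have h0 := triv_sum (1 : AddChar K ℂ) a b c ha
  rw [AddChar.sum_eq_card_of_eq_one rfl, ← hW0] at h0
  have hrest : ‖∑ t ∈ P.erase (∅, (∅, ∅)), W t‖ ≤
      ((P.erase (∅, (∅, ∅))).card : ℝ) * (3 * Real.sqrt (Fintype.card K)) := by
    rw [← nsmul_eq_mul, ← Finset.sum_const]
    refine (norm_sum_le _ _).trans (Finset.sum_le_sum fun t ht => ?_)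
    obtain ⟨hne, ht⟩ := Finset.mem_erase.1 ht
    rw [hP, Finset.mem_product, Finset.mem_product, Finset.mem_powerset, Finset.mem_powerset,
      Finset.mem_powerset] at ht
    simp only [hW, norm_mul, norm_pow, norm_neg, norm_one, one_pow, one_mul]
    refine weil_all _ _ _ a b c ha hdisc ?_
    rintro ⟨e1, e2, e3⟩
    apply hne
    rw [Prod.ext_iff, Prod.ext_iff]
    exact ⟨h₁ _ ht.1 e1, h₂ _ ht.2.1 e2, h₃ _ ht.2.2 e3⟩
  have hcard : ((P.erase (∅, (∅, ∅))).card : ℝ) = 2 ^ S₁.card * 2 ^ S₂.card * 2 ^ S₃.card - 1 := by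
    rw [Finset.card_erase_of_mem hmem, Nat.cast_sub (Finset.card_pos.2 ⟨_, hmem⟩), hP,
      Finset.card_product, Finset.card_product]
    simp only [Finset.card_powerset]
    push_cast; ring
  rw [hcard] at hrest
  have h5 : W (∅, (∅, ∅)) = - ∑ t ∈ P.erase (∅, (∅, ∅)), W t := by linear_combination htot
  rw [← norm_neg, ← h5] at hrest
  have h6 : (Fintype.card K : ℝ) ≤ ‖W (∅, (∅, ∅))‖ + 3 := by
    have := norm_sub_norm_le (Fintype.card K : ℂ) (W (∅, (∅, ∅)))
    rw [Complex.norm_natCast, norm_sub_rev] at this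
    linarith
  set s := Real.sqrt (Fintype.card K) with hs
  have hss : (Fintype.card K : ℝ) = s * s := (Real.mul_self_sqrt (Nat.cast_nonneg _)).symm
  have hs1 : 1 < s := by
    have : (1 : ℝ) ≤ 2 ^ S₁.card * 2 ^ S₂.card * 2 ^ S₃.card := by
      have h := fun n : ℕ => one_le_pow₀ (M₀ := ℝ) (n := n) (one_le_two)
      exact one_le_mul_of_one_le_of_one_le (one_le_mul_of_one_le_of_one_le (h _) (h _)) (h _)
    linarith
  nlinarith

theorem mul_indep {K : Type*} [Field K] (χ : ℕ → MulChar K ℂ) (S : Finset ℕ)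
    (hS : ∀ l ∈ S, l.Prime ∧ orderOf (χ l) = l) (T : Finset ℕ) (hT : T ⊆ S)
    (h : ∏ l ∈ T, χ l = 1) : T = ∅ := by
  by_contra hne
  obtain ⟨l₀, hl₀⟩ := Finset.nonempty_iff_ne_empty.2 hne
  rw [← Finset.mul_prod_erase _ _ hl₀] at h
  set N := ∏ l ∈ T.erase l₀, l with hN
  have h1 : (∏ l ∈ T.erase l₀, χ l) ^ N = 1 := by
    rw [← Finset.prod_pow]
    refine Finset.prod_eq_one fun l hl => ?_
    rw [← orderOf_dvd_iff_pow_eq_one, (hS l (hT (Finset.mem_of_mem_erase hl))).2]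
    exact Finset.dvd_prod_of_mem _ hl
  have h2 : χ l₀ ^ N = 1 := by
    have := congrArg (· ^ N) h
    simpa [mul_pow, h1] using this
  rw [← orderOf_dvd_iff_pow_eq_one, (hS l₀ (hT hl₀)).2] at h2
  have hp := (hS l₀ (hT hl₀)).1
  obtain ⟨l, hl, hdvd⟩ := (hp.prime.dvd_finset_prod_iff _).1 h2
  have := (Nat.prime_dvd_prime_iff_eq hp (hS l (hT (Finset.mem_of_mem_erase hl))).1).1 hdvd
  exact (Finset.ne_of_mem_erase hl) this.symm

theorem exists_chi {K : Type*} [Field K] [Fintype K] (e : ℕ) (he : e ∣ Fintype.card K - 1) :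
    ∃ χ : ℕ → MulChar K ℂ, ∀ l ∈ e.primeFactors, l.Prime ∧ orderOf (χ l) = l := by
  have : ∀ l : ℕ, ∃ χ : MulChar K ℂ, l ∈ e.primeFactors → l.Prime ∧ orderOf χ = l := by
    intro l
    by_cases hl : l ∈ e.primeFactors
    · have hp := Nat.prime_of_mem_primeFactors hl
      obtain ⟨χ, hχ⟩ := MulChar.exists_mulChar_orderOf K
        ((Nat.dvd_of_mem_primeFactors hl).trans he) (Complex.isPrimitiveRoot_exp l hp.ne_zero)
      exact ⟨χ, fun _ => ⟨hp, hχ⟩⟩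
    · exact ⟨1, fun h => absurd h hl⟩
  choose χ hχ using this
  exact ⟨χ, hχ⟩

theorem efree_of {K : Type*} [Field K] [Fintype K] (e : ℕ) (he : e ∣ Fintype.card K - 1)
    (χ : ℕ → MulChar K ℂ) (hχ : ∀ l ∈ e.primeFactors, l.Prime ∧ orderOf (χ l) = l) (α : K)
    (hα : α ≠ 0) (h : ∀ l ∈ e.primeFactors, χ l α ≠ 1) (d : ℕ) (hd : d ∣ e)
    (hβ : ∃ β : K, α = β ^ d) : d = 1 := by
  by_contra hd1
  obtain ⟨β, rfl⟩ := hβ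
  obtain ⟨l, hl, k, rfl⟩ := Nat.exists_prime_and_dvd hd1
  have he0 : e ≠ 0 := by
    rintro rfl
    have := Fintype.one_lt_card (α := K)
    have := Nat.eq_zero_of_zero_dvd he
    omega
  have hle : l ∈ e.primeFactors :=
    Nat.mem_primeFactors.2 ⟨hl, (dvd_mul_right _ _).trans hd, he0⟩
  apply h l hle
  have hb : β ^ k ≠ 0 := by
    intro h0; apply hα; rw [mul_comm, pow_mul, h0, zero_pow hl.ne_zero]
  have h1 : χ l ^ l = 1 := by
    have := pow_orderOf_eq_one (χ l)
    rwa [(hχ l hle).2] at this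
  rw [mul_comm, pow_mul, map_pow, ← MulChar.pow_apply' _ hl.ne_zero, h1,
    MulChar.one_apply hb.isUnit]
theorem polyAct_eq (F : Type*) {K : Type*} [Field F] [Fintype F] [Field K] [Algebra F K]
    (h : F[X]) (α : K) :
    polyAct F h α = aeval (FiniteField.frobeniusAlgHom F K).toLinearMap h α := by
  rw [aeval_endomorphism, polyAct]
  congr 1
  ext i a
  rw [Algebra.smul_def]
  congr 1
  induction i with
  | zero => simp
  | succ n ih =>
    rw [pow_succ' (FiniteField.frobeniusAlgHom F K).toLinearMap, Module.End.mul_apply, ← ih]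
    simp [pow_succ, pow_mul]

theorem exists_psi_one {F K : Type*} [Field F] [Fintype F] [Field K] [Fintype K] [Algebra F K]
    (π : F[X]) (hπ : Irreducible π) (hd : π ∣ X ^ Module.finrank F K - 1) :
    ∃ ψ : AddChar K ℂ, ψ ≠ 1 ∧ ∀ x, ψ (polyAct F π x) = 1 := by
  set Φ := (FiniteField.frobeniusAlgHom F K).toLinearMap with hΦ
  have hfin : FiniteDimensional F K := Module.Finite.of_finite
  have hm := FiniteField.minpoly_frobeniusAlgHom F K
  rw [← hΦ] at hm
  have hns : LinearMap.range (aeval Φ π) ≠ ⊤ := by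
    intro htop
    have hinj : Function.Injective (aeval Φ π) :=
      LinearMap.injective_iff_surjective.2 (LinearMap.range_eq_top.1 htop)
    obtain ⟨h, hh⟩ := hd
    have h0 : X ^ Module.finrank F K - 1 ≠ (0 : F[X]) := by
      rw [← hm]; exact minpoly.ne_zero (Algebra.IsIntegral.isIntegral Φ)
    have hz : aeval Φ h = 0 := by
      ext x
      apply hinj
      have h1 : aeval Φ (X ^ Module.finrank F K - 1 : F[X]) = 0 := by rw [← hm]; exact minpoly.aeval _ _
      rw [hh, map_mul] at h1
      have h2 := congrArg (fun T => T x) h1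
      simpa [Module.End.mul_apply] using h2
    have hdvd := minpoly.dvd F Φ hz
    rw [hm, hh] at hdvd
    have hh0 : h ≠ 0 := by rintro rfl; rw [mul_zero] at hh; exact h0 hh
    obtain ⟨k, hk⟩ := hdvd
    apply hπ.not_isUnit
    refine IsUnit.of_mul_eq_one k ?_
    apply mul_right_cancel₀ hh0
    rw [one_mul]
    nth_rewrite 2 [hk]
    ring
  set R := LinearMap.range (aeval Φ π) with hR
  obtain ⟨v, hv⟩ : ∃ v, v ∉ R := by
    by_contra hcon
    push Not at hcon
    exact hns (Submodule.eq_top_iff'.2 hcon)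
  have hv' : (R.mkQ v) ≠ 0 := by simpa using hv
  have : Finite (K ⧸ R) := Finite.of_surjective R.mkQ R.mkQ_surjective
  obtain ⟨ψ, hψ⟩ := AddChar.exists_apply_ne_zero.2 hv'
  refine ⟨ψ.compAddMonoidHom R.mkQ.toAddMonoidHom, fun h => hψ ?_, fun x => ?_⟩
  · exact AddChar.eq_one_iff.1 h v
  · rw [AddChar.compAddMonoidHom_apply, polyAct_eq]
    have : R.mkQ (aeval Φ π x) = 0 := by
      rw [Submodule.mkQ_apply, Submodule.Quotient.mk_eq_zero]; exact ⟨x, rfl⟩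
    change ψ (R.mkQ (aeval Φ π x)) = 1
    rw [this, AddChar.map_zero_eq_one]

theorem polyAct_mul (F : Type*) {K : Type*} [Field F] [Fintype F] [Field K] [Algebra F K]
    (g h : F[X]) (α : K) : polyAct F (g * h) α = polyAct F g (polyAct F h α) := by
  simp only [polyAct_eq, map_mul, Module.End.mul_apply]

theorem add_indep {F K : Type*} [Field F] [Fintype F] [Field K] [Algebra F K]
    (ψ : F[X] → AddChar K ℂ) (S : Finset F[X]) (hS : ∀ π ∈ S, Irreducible π ∧ π.Monic)
    (hψ : ∀ π ∈ S, ψ π ≠ 1 ∧ ∀ x, ψ π (polyAct F π x) = 1) (T : Finset F[X]) (hT : T ⊆ S)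
    (h : ∏ π ∈ T, ψ π = 1) : T = ∅ := by
  classical
  by_contra hne
  obtain ⟨π₀, h₀⟩ := Finset.nonempty_iff_ne_empty.2 hne
  rw [← Finset.mul_prod_erase _ _ h₀] at h
  set M := ∏ π ∈ T.erase π₀, π with hM
  have hcop : IsCoprime M π₀ := by
    refine IsCoprime.prod_left fun π hπ => ?_
    have h1 := hS π (hT (Finset.mem_of_mem_erase hπ))
    have h2 := hS π₀ (hT h₀)
    rw [h1.1.coprime_iff_not_dvd]
    intro hd
    exact Finset.ne_of_mem_erase hπ
      (eq_of_monic_of_associated h1.2 h2.2 (h1.1.associated_of_dvd h2.1 hd))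
  have hMx : ∀ x, ψ π₀ (polyAct F M x) = 1 := by
    intro x
    have h1 := congrArg (fun f => f (polyAct F M x)) h
    simp only [AddChar.mul_apply, addChar_prod_apply, AddChar.one_apply] at h1
    rw [Finset.prod_eq_one, mul_one] at h1
    · exact h1
    · intro π hπ
      rw [hM, ← Finset.mul_prod_erase _ _ hπ, polyAct_mul]
      exact (hψ π (hT (Finset.mem_of_mem_erase hπ))).2 _
  obtain ⟨u, v, huv⟩ := hcop
  apply (hψ π₀ (hT h₀)).1
  rw [AddChar.eq_one_iff]
  intro x
  have hx : x = polyAct F M (polyAct F u x) + polyAct F π₀ (polyAct F v x) := by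
    rw [← polyAct_mul, ← polyAct_mul, mul_comm M, mul_comm π₀]
    simp only [polyAct_eq]
    rw [← LinearMap.add_apply, ← map_add, huv, map_one, Module.End.one_apply]
  rw [hx, AddChar.map_add_eq_mul, hMx, (hψ π₀ (hT h₀)).2, mul_one]

theorem exists_free_of_gt (p r q m : ℕ) (hp : p.Prime) (hodd : Odd p) (hr : 0 < r)
    (hq : q = p ^ r) (hm : 2 ≤ m)
    (F K : Type*) [Field F] [Fintype F] [DecidableEq F] [Field K] [Algebra F K]
    (hF : Fintype.card F = q) (hK : Module.finrank F K = m)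
    (a b c : K) (ha : a ≠ 0) (hdisc : b ^ 2 - 4 * a * c ≠ 0)
    (e₁ e₂ : ℕ) (he₁ : e₁ ∣ q ^ m - 1) (he₂ : e₂ ∣ q ^ m - 1)
    (g : Polynomial F) (hg : g.Monic) (hgdvd : g ∣ X ^ m - 1)
    (hcond : Real.sqrt ((q : ℝ) ^ m) >
      3 * 2 ^ e₁.primeFactors.card * 2 ^ e₂.primeFactors.card *
        2 ^ (UniqueFactorizationMonoid.normalizedFactors g).toFinset.card) :
    ∃ α : K, IsEFree e₁ α ∧ IsGFree F g α ∧ IsEFree e₂ (a * α ^ 2 + b * α + c) := by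
  classical
  have hfd : FiniteDimensional F K := Module.finite_of_finrank_pos (by omega)
  have : Finite K := Module.finite_of_finite F
  letI : Fintype K := Fintype.ofFinite K
  have hcard : Fintype.card K = q ^ m := by
    rw [Module.card_eq_pow_finrank (K := F), hF, hK]
  rw [← hcard] at he₁ he₂
  obtain ⟨χ, hχ⟩ := exists_chi (K := K) e₁ he₁
  obtain ⟨χ', hχ'⟩ := exists_chi (K := K) e₂ he₂
  set S := (UniqueFactorizationMonoid.normalizedFactors g).toFinset with hS
  have hSp : ∀ π ∈ S, Irreducible π ∧ π.Monic ∧ π ∣ g := by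
    intro π hπ
    rw [hS, Multiset.mem_toFinset] at hπ
    have hirr := UniqueFactorizationMonoid.irreducible_of_normalized_factor π hπ
    refine ⟨hirr, ?_, UniqueFactorizationMonoid.dvd_of_mem_normalizedFactors hπ⟩
    rw [← UniqueFactorizationMonoid.normalize_normalized_factor π hπ]
    exact monic_normalize hirr.ne_zero
  have hψex : ∀ π : F[X], ∃ ψ : AddChar K ℂ, π ∈ S → ψ ≠ 1 ∧ ∀ x, ψ (polyAct F π x) = 1 := by
    intro π
    by_cases hπ : π ∈ S
    · obtain ⟨h1, _, h3⟩ := hSp π hπ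
      obtain ⟨ψ, hψ⟩ := exists_psi_one (F := F) (K := K) π h1 (by rw [hK]; exact h3.trans hgdvd)
      exact ⟨ψ, fun _ => hψ⟩
    · exact ⟨1, fun h => absurd h hπ⟩
  choose ψ hψ using hψex
  obtain ⟨x, hx0, hfx0, h1, h2, h3⟩ := sieve χ χ' ψ e₁.primeFactors e₂.primeFactors S
    (mul_indep χ _ hχ) (mul_indep χ' _ hχ')
    (add_indep ψ S (fun π hπ => ⟨(hSp π hπ).1, (hSp π hπ).2.1⟩) hψ) a b c ha hdisc
    (by rw [hcard]; push_cast; exact hcond)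
  refine ⟨x, ⟨hx0, efree_of e₁ he₁ χ hχ x hx0 h1⟩, ?_, ⟨hfx0, efree_of e₂ he₂ χ' hχ' _ hfx0 h2⟩⟩
  intro h hmon hdvd hβ
  obtain ⟨β, rfl⟩ := hβ
  by_contra hne
  have hnu : ¬ IsUnit h := fun hu => hne (hmon.eq_one_of_isUnit hu)
  obtain ⟨π', hπ', hπh⟩ := WfDvdMonoid.exists_irreducible_factor hnu hmon.ne_zero
  obtain ⟨π, hπ, hass⟩ := UniqueFactorizationMonoid.exists_mem_normalizedFactors_of_dvd hg.ne_zero hπ'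
    (hπh.trans hdvd)
  have hπS : π ∈ S := Multiset.mem_toFinset.2 hπ
  obtain ⟨k, rfl⟩ := hass.symm.dvd.trans hπh
  apply h3 π hπS
  rw [polyAct_mul]
  exact (hψ π hπS).2 _
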